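/- arXiv:1504.03975 — 6 statements merged into one kernel-verified Lean document; each statement's English description precedes it below -/
import Mathlib

section
/- For every ε > 0, every integer k ≥ 2 and every finite set Ω there exists η = η(ε,k,Ω) > 0 such that for every n > 1/η, every probability measure μ on Ω^n admits pairwise disjoint (ε,k)-states S₁,…,S_N with μ(S_i) ≥ η for all i ∈ [N] and Σ_{i=1}^N μ(S_i) ≥ 1 − ε. -/
open Finset

noncomputable section

/-- `μ` is a probability mass function on the finite type `X`. -/
def IsPMF {X : Type*} [Fintype X] (μ : X → ℝ) : Prop :=
  (∀ x, 0 ≤ μ x) ∧ ∑ x, μ x = 1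

/-- Total variation distance between two mass functions (half the `L¹` distance,
so that `‖ν − ν'‖_TV = max_A |ν(A) − ν'(A)|` for probability measures). -/
def tv {X : Type*} [Fintype X] (p q : X → ℝ) : ℝ :=
  (∑ x, |p x - q x|) / 2

/-- Expectation `⟨f⟩_μ` of `f` under `μ`. -/
def expec {X : Type*} [Fintype X] (μ : X → ℝ) (f : X → ℝ) : ℝ :=
  ∑ x, μ x * f x

/-- Mass `μ(S)` of a finite set `S`. -/
def mass {X : Type*} (μ : X → ℝ) (S : Finset X) : ℝ :=
  ∑ x ∈ S, μ x

/-- The conditional measure `μ[·|S]`. -/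
def condPMF {X : Type*} [DecidableEq X] (μ : X → ℝ) (S : Finset X) (x : X) : ℝ :=
  if x ∈ S then μ x / mass μ S else 0

/-- The conditional expectation `⟨f | S⟩_μ`. -/
def condExpect {X : Type*} (μ : X → ℝ) (S : Finset X) (f : X → ℝ) : ℝ :=
  (∑ x ∈ S, μ x * f x) / mass μ S

/-- Empirical distribution `σ[·|S]` of the values of `σ` on `S`. -/
def empDist {V Ω : Type*} [DecidableEq Ω] (σ : V → Ω) (S : Finset V) (ω : Ω) : ℝ :=
  ((S.filter fun x => σ x = ω).card : ℝ) / (S.card : ℝ)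

/-- The marginal law `μ_↓x` of the coordinate `x` under `μ ∈ P(Ω^n)`. -/
def marg1 {Ω : Type*} [Fintype Ω] [DecidableEq Ω] {n : ℕ} (μ : (Fin n → Ω) → ℝ)
    (x : Fin n) (ω : Ω) : ℝ :=
  ∑ σ ∈ Finset.univ.filter (fun σ : Fin n → Ω => σ x = ω), μ σ

/-- The joint law `μ_↓(x₁,…,x_k)` of the coordinates `xs` under `μ ∈ P(Ω^n)`. -/
def margLaw {Ω : Type*} [Fintype Ω] [DecidableEq Ω] {n k : ℕ} (μ : (Fin n → Ω) → ℝ)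
    (xs : Fin k → Fin n) (τ : Fin k → Ω) : ℝ :=
  ∑ σ ∈ Finset.univ.filter (fun σ : Fin n → Ω => ∀ i, σ (xs i) = τ i), μ σ

/-- The joint law `μ_↓(x,y)` of a pair of coordinates under `μ ∈ P(Ω^n)`. -/
def pairLaw {Ω : Type*} [Fintype Ω] [DecidableEq Ω] {n : ℕ} (μ : (Fin n → Ω) → ℝ)
    (x y : Fin n) (τ : Ω × Ω) : ℝ :=
  ∑ σ ∈ Finset.univ.filter (fun σ : Fin n → Ω => σ x = τ.1 ∧ σ y = τ.2), μ σ

/-- `(1/n^k) Σ_{x₁,…,x_k} ‖μ_↓(x₁,…,x_k) − μ_↓x₁ ⊗ ⋯ ⊗ μ_↓x_k‖_TV`. -/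
def stateSum {Ω : Type*} [Fintype Ω] [DecidableEq Ω] {n : ℕ} (k : ℕ)
    (μ : (Fin n → Ω) → ℝ) : ℝ :=
  (1 / (n : ℝ) ^ k) * ∑ xs : Fin k → Fin n,
    tv (margLaw μ xs) (fun τ : Fin k → Ω => ∏ i, marg1 μ (xs i) (τ i))

/-- `S` is an `(ε,k)`-state of `μ`. -/
def IsState {Ω : Type*} [Fintype Ω] [DecidableEq Ω] {n : ℕ} (ε : ℝ) (k : ℕ)
    (μ : (Fin n → Ω) → ℝ) (S : Finset (Fin n → Ω)) : Prop :=
  0 < mass μ S ∧ stateSum k (condPMF μ S) < ε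

/-- `μ` is `(ε,k)`-symmetric. -/
def IsSymmetric {Ω : Type*} [Fintype Ω] [DecidableEq Ω] {n : ℕ} (ε : ℝ) (k : ℕ)
    (μ : (Fin n → Ω) → ℝ) : Prop :=
  stateSum k μ < ε

/-- A partition of a type `X` into finitely many nonempty finite classes. -/
structure FinPartition (X : Type*) where
  k : ℕ
  part : Fin k → Finset X
  nonempty : ∀ i, (part i).Nonempty
  disj : ∀ i j, i ≠ j → Disjoint (part i) (part j)
  covers : ∀ x, ∃ i, x ∈ part i

/-- `W` refines `V`: every class of `W` is contained in a class of `V`. -/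
def FinPartition.Refines {X : Type*} (W V : FinPartition X) : Prop :=
  ∀ i, ∃ j, W.part i ⊆ V.part j

/-- `μ` is `ε`-regular on the set `U ⊆ [n]`. -/
def regularOn {Ω : Type*} [Fintype Ω] [DecidableEq Ω] {n : ℕ} (ε : ℝ)
    (μ : (Fin n → Ω) → ℝ) (U : Finset (Fin n)) : Prop :=
  ∀ S ⊆ U, ε * (U.card : ℝ) ≤ (S.card : ℝ) →
    expec μ (fun σ => tv (empDist σ S) (empDist σ U)) < ε

/-- `μ` is `ε`-regular with respect to a partition `V` of `[n]`. -/
def regularPart {Ω : Type*} [Fintype Ω] [DecidableEq Ω] {n : ℕ} (ε : ℝ)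
    (μ : (Fin n → Ω) → ℝ) (V : FinPartition (Fin n)) : Prop :=
  ∃ J : Finset (Fin V.k),
    (∑ i ∈ Finset.univ \ J, ((V.part i).card : ℝ)) < ε * n ∧
    ∀ i ∈ J, regularOn ε μ (V.part i)

/-- `μ` is `ε`-homogeneous with respect to `(V, S)`. -/
def homogeneous {Ω : Type*} [Fintype Ω] [DecidableEq Ω] {n : ℕ} (ε : ℝ)
    (μ : (Fin n → Ω) → ℝ) (V : FinPartition (Fin n)) (S : FinPartition (Fin n → Ω)) : Prop :=
  ∃ I : Finset (Fin S.k),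
    (∀ i ∈ I, 0 < mass μ (S.part i)) ∧
    (∑ i ∈ Finset.univ \ I, mass μ (S.part i)) < ε ∧
    (∀ i : Fin S.k, ∀ j : Fin V.k, ∀ σ ∈ S.part i, ∀ σ' ∈ S.part i,
       tv (empDist σ (V.part j)) (empDist σ' (V.part j)) < ε) ∧
    (∀ i ∈ I, regularPart ε (condPMF μ (S.part i)) V) ∧
    regularPart ε μ V

/-- The index `ind_μ(V)` of `μ` with respect to the partition `V`. -/
def muIndex {Ω : Type*} [Fintype Ω] [DecidableEq Ω] {n : ℕ}
    (μ : (Fin n → Ω) → ℝ) (V : FinPartition (Fin n)) : ℝ :=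
  (1 / ((Fintype.card Ω : ℝ) * n)) * ∑ ω : Ω, ∑ j : Fin V.k, ∑ x ∈ V.part j,
    expec μ (fun σ => ((if σ x = ω then (1 : ℝ) else 0) - empDist σ (V.part j) ω) ^ 2)

/-- The product measure `μ ⊗ μ`, regarded as a measure on `(Ω × Ω)^n`. -/
def tensorPMF {Ω : Type*} {n : ℕ} (μ : (Fin n → Ω) → ℝ) : (Fin n → Ω × Ω) → ℝ :=
  fun σ => μ (fun i => (σ i).1) * μ (fun i => (σ i).2)

/-- The `n`-fold product `p^{⊗n}` of `p ∈ P(Ω)`. -/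
def productPMF {Ω : Type*} [Fintype Ω] {n : ℕ} (p : Ω → ℝ) : (Fin n → Ω) → ℝ :=
  fun σ => ∏ i, p (σ i)

/-- Entropy `H(q)` of a mass function. -/
def entropy {X : Type*} [Fintype X] (q : X → ℝ) : ℝ :=
  -∑ x, q x * Real.log (q x)

/-- Kullback–Leibler divergence `KL(ν‖μ)`. -/
def klDiv {X : Type*} [Fintype X] (ν μ : X → ℝ) : ℝ :=
  ∑ x, ν x * Real.log (ν x / μ x)

/-- The `j`-th marginal `q_↓j` of `q ∈ P(Ω^d)`. -/
def margOf {Ω : Type*} [Fintype Ω] [DecidableEq Ω] {d : ℕ} (q : (Fin d → Ω) → ℝ)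
    (j : Fin d) (ω : Ω) : ℝ :=
  ∑ τ ∈ Finset.univ.filter (fun τ : Fin d → Ω => τ j = ω), q τ


section aux
variable {Ω : Type} [Fintype Ω] [DecidableEq Ω] {n : ℕ}

def pinW (w : (Fin n → Ω) → ℝ) (x : Fin n) (ω : Ω) : (Fin n → Ω) → ℝ :=
  fun σ => if σ x = ω then w σ else 0

def totW (w : (Fin n → Ω) → ℝ) : ℝ := ∑ σ, w σ

def PhiW : ℕ → ((Fin n → Ω) → ℝ) → ℝ
  | 0, w => (1 / (n : ℝ)) * ∑ x : Fin n, ∑ ω : Ω, (totW (pinW w x ω)) ^ 2 / totW w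
  | t + 1, w => (1 / (n : ℝ)) * ∑ x : Fin n, ∑ ω : Ω, PhiW t (pinW w x ω)

def ellW (p : Fin n → Ω → ℝ) (w : (Fin n → Ω) → ℝ) : ℝ :=
  (1 / (n : ℝ)) * ∑ x : Fin n, ∑ ω : Ω,
    (2 * totW (pinW w x ω) * p x ω - totW w * p x ω ^ 2)

lemma pinW_nonneg {w : (Fin n → Ω) → ℝ} (hw : ∀ σ, 0 ≤ w σ) (x : Fin n) (ω : Ω) :
    ∀ σ, 0 ≤ pinW w x ω σ := by
  intro σ; unfold pinW; split_ifs <;> simp [hw]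

lemma totW_nonneg {w : (Fin n → Ω) → ℝ} (hw : ∀ σ, 0 ≤ w σ) : 0 ≤ totW w :=
  Finset.sum_nonneg fun σ _ => hw σ

lemma sum_totW_pinW (w : (Fin n → Ω) → ℝ) (x : Fin n) :
    ∑ ω, totW (pinW w x ω) = totW w := by
  unfold totW pinW
  rw [Finset.sum_comm]
  simp

lemma pinW_comm (w : (Fin n → Ω) → ℝ) (x y : Fin n) (ω ω' : Ω) :
    pinW (pinW w x ω) y ω' = pinW (pinW w y ω') x ω := by
  funext σ; unfold pinW; split_ifs <;> rfl

lemma totW_pinW_le {w : (Fin n → Ω) → ℝ} (hw : ∀ σ, 0 ≤ w σ) (x : Fin n) (ω : Ω) :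
    totW (pinW w x ω) ≤ totW w := by
  rw [← sum_totW_pinW w x]
  exact Finset.single_le_sum (f := fun ω => totW (pinW w x ω))
    (fun ω _ => totW_nonneg (pinW_nonneg hw x ω)) (Finset.mem_univ ω)

lemma avg_const (hn : 0 < n) (c : ℝ) : (1 / (n : ℝ)) * ∑ _x : Fin n, c = c := by
  have : (n : ℝ) ≠ 0 := by positivity
  simp; field_simp

lemma ellW_pinW (p : Fin n → Ω → ℝ) (w : (Fin n → Ω) → ℝ) (y : Fin n) :
    ∑ ω, ellW p (pinW w y ω) = ellW p w := by
  unfold ellW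
  rw [← Finset.mul_sum, Finset.sum_comm]
  congr 1
  refine Finset.sum_congr rfl fun x _ => ?_
  rw [Finset.sum_comm]
  refine Finset.sum_congr rfl fun ω _ => ?_
  rw [Finset.sum_sub_distrib, ← Finset.sum_mul, ← Finset.sum_mul, ← Finset.mul_sum,
    sum_totW_pinW]
  simp_rw [pinW_comm w y x]
  rw [sum_totW_pinW]

lemma ellW_le {w : (Fin n → Ω) → ℝ} (hw : ∀ σ, 0 ≤ w σ) (p : Fin n → Ω → ℝ) :
    ellW p w ≤ PhiW 0 w := by
  unfold ellW PhiW
  refine mul_le_mul_of_nonneg_left ?_ (by positivity)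
  refine Finset.sum_le_sum fun x _ => Finset.sum_le_sum fun ω _ => ?_
  have h1 := totW_nonneg (pinW_nonneg hw x ω)
  have h2 := totW_pinW_le hw x ω
  rcases (totW_nonneg hw).eq_or_lt with h | h
  · have : totW (pinW w x ω) = 0 := by linarith
    simp [this, ← h]
  · rw [le_div_iff₀ h]
    nlinarith [sq_nonneg (totW (pinW w x ω) - totW w * p x ω)]

lemma ellW_self {w : (Fin n → Ω) → ℝ} (hw : ∀ σ, 0 ≤ w σ) :
    ellW (fun x ω => totW (pinW w x ω) / totW w) w = PhiW 0 w := by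
  unfold ellW PhiW
  congr 1
  refine Finset.sum_congr rfl fun x _ => Finset.sum_congr rfl fun ω _ => ?_
  rcases (totW_nonneg hw).eq_or_lt with h | h
  · simp [← h]
  · field_simp; ring

lemma PhiW_mono0 (hn : 0 < n) {w : (Fin n → Ω) → ℝ} (hw : ∀ σ, 0 ≤ w σ) :
    PhiW 0 w ≤ PhiW 1 w := by
  rw [← ellW_self hw, PhiW]
  set p : Fin n → Ω → ℝ := (fun x ω => totW (pinW w x ω) / totW w)
  conv_lhs => rw [← avg_const hn (ellW p w)]
  refine mul_le_mul_of_nonneg_left ?_ (by positivity)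
  refine Finset.sum_le_sum fun x _ => ?_
  rw [← ellW_pinW p w x]
  exact Finset.sum_le_sum fun ω _ => ellW_le (pinW_nonneg hw x ω) p

lemma PhiW_step (hn : 0 < n) (t : ℕ) : ∀ {w : (Fin n → Ω) → ℝ} (_ : ∀ σ, 0 ≤ w σ),
    PhiW t w ≤ PhiW (t + 1) w := by
  induction t with
  | zero => intro w hw; exact PhiW_mono0 hn hw
  | succ t ih =>
    intro w hw
    rw [PhiW, PhiW]
    refine mul_le_mul_of_nonneg_left ?_ (by positivity)
    exact Finset.sum_le_sum fun x _ => Finset.sum_le_sum fun ω _ => ih (pinW_nonneg hw x ω)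

lemma PhiW_mono (hn : 0 < n) {w : (Fin n → Ω) → ℝ} (hw : ∀ σ, 0 ≤ w σ) {s t : ℕ}
    (h : s ≤ t) : PhiW s w ≤ PhiW t w :=
  monotone_nat_of_le_succ (f := fun t => PhiW t w) (fun t => PhiW_step hn t hw) h

lemma PhiW_nonneg (t : ℕ) : ∀ {w : (Fin n → Ω) → ℝ} (_ : ∀ σ, 0 ≤ w σ), 0 ≤ PhiW t w := by
  induction t with
  | zero =>
    intro w hw
    rw [PhiW]
    have := totW_nonneg hw
    positivity
  | succ t ih =>
    intro w hw
    rw [PhiW]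
    exact mul_nonneg (by positivity) (Finset.sum_nonneg fun x _ => Finset.sum_nonneg fun ω _ =>
      ih (pinW_nonneg hw x ω))

lemma PhiW_le (hn : 0 < n) (t : ℕ) : ∀ {w : (Fin n → Ω) → ℝ} (_ : ∀ σ, 0 ≤ w σ),
    PhiW t w ≤ totW w := by
  induction t with
  | zero =>
    intro w hw
    rw [PhiW, ← avg_const hn (totW w)]
    refine mul_le_mul_of_nonneg_left ?_ (by positivity)
    refine Finset.sum_le_sum fun x _ => ?_
    rw [avg_const hn, ← sum_totW_pinW w x]
    refine Finset.sum_le_sum fun ω _ => ?_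
    rw [sum_totW_pinW]
    have h1 := totW_nonneg (pinW_nonneg hw x ω)
    have h2 := totW_pinW_le hw x ω
    exact div_le_of_le_mul₀ (by linarith) h1 (by nlinarith)
  | succ t ih =>
    intro w hw
    rw [PhiW, ← avg_const hn (totW w)]
    refine mul_le_mul_of_nonneg_left ?_ (by positivity)
    refine Finset.sum_le_sum fun x _ => ?_
    rw [← sum_totW_pinW w x]
    exact Finset.sum_le_sum fun ω _ => ih (pinW_nonneg hw x ω)

lemma totW_smul (c : ℝ) (w : (Fin n → Ω) → ℝ) : totW (fun σ => c * w σ) = c * totW w := by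
  unfold totW; rw [Finset.mul_sum]

lemma pinW_smul (c : ℝ) (w : (Fin n → Ω) → ℝ) (x : Fin n) (ω : Ω) :
    pinW (fun σ => c * w σ) x ω = fun σ => c * pinW w x ω σ := by
  funext σ; unfold pinW; split_ifs <;> simp

lemma PhiW_smul {c : ℝ} (hc : 0 < c) (t : ℕ) : ∀ (w : (Fin n → Ω) → ℝ),
    PhiW t (fun σ => c * w σ) = c * PhiW t w := by
  induction t with
  | zero =>
    intro w
    simp only [PhiW, pinW_smul, totW_smul]
    rw [mul_left_comm]
    congr 1
    rw [Finset.mul_sum]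
    refine Finset.sum_congr rfl fun x _ => ?_
    rw [Finset.mul_sum]
    refine Finset.sum_congr rfl fun ω _ => ?_
    rw [mul_pow, pow_two c, mul_assoc, mul_div_mul_left _ _ hc.ne', mul_div_assoc]
  | succ t ih =>
    intro w
    simp only [PhiW, pinW_smul, ih, ← Finset.mul_sum]
    ring

lemma sum_consW {α : Type*} [Fintype α] {k : ℕ} (f : (Fin (k+1) → α) → ℝ) :
    ∑ v, f v = ∑ a : α, ∑ v : Fin k → α, f (Fin.cons a v) := by
  rw [← (Fin.consEquiv (fun _ => α)).sum_comp, Fintype.sum_prod_type]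
  rfl

lemma exists_label (hn : 0 < n) (k t : ℕ) : ∀ (w : (Fin n → Ω) → ℝ),
    ∃ L : (Fin n → Ω) → (Fin t → Ω),
      ∑ c, (PhiW k (fun σ => if L σ = c then w σ else 0)
        - PhiW 0 (fun σ => if L σ = c then w σ else 0)) ≤ PhiW (t + k) w - PhiW t w := by
  induction t with
  | zero =>
    intro w
    refine ⟨fun _ => Fin.elim0, ?_⟩
    simp [Subsingleton.elim _ (default : Fin 0 → Ω)]
  | succ t ih =>
    intro w
    have hx : ∃ x : Fin n, ∑ ω, (PhiW (t + k) (pinW w x ω) - PhiW t (pinW w x ω))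
        ≤ PhiW (t + 1 + k) w - PhiW (t + 1) w := by
      by_contra! hcon
      have : Nonempty (Fin n) := ⟨⟨0, hn⟩⟩
      have h := Finset.sum_lt_sum_of_nonempty (Finset.univ_nonempty (α := Fin n))
        (fun x _ => hcon x)
      have hn' : (0 : ℝ) < 1 / n := by positivity
      have h2 := mul_lt_mul_of_pos_left h hn'
      rw [avg_const hn] at h2
      rw [show t + 1 + k = (t + k) + 1 by ring, PhiW, PhiW, ← mul_sub,
        ← Finset.sum_sub_distrib] at h2
      simp_rw [Finset.sum_sub_distrib] at h2
      exact lt_irrefl _ h2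
    obtain ⟨x, hx⟩ := hx
    choose L hL using fun ω => ih (pinW w x ω)
    refine ⟨fun σ => Fin.cons (σ x) (L (σ x) σ), le_trans ?_ hx⟩
    rw [sum_consW]
    refine Finset.sum_le_sum fun ω _ => ?_
    refine le_trans (le_of_eq ?_) (hL ω)
    refine Finset.sum_congr rfl fun c _ => ?_
    have : (fun σ : Fin n → Ω => if (Fin.cons (σ x) (L (σ x) σ) : Fin (t+1) → Ω)
        = Fin.cons ω c then w σ else 0)
        = fun σ => if L ω σ = c then pinW w x ω σ else 0 := by
      funext σ
      simp only [Fin.cons_inj, pinW]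
      by_cases h : σ x = ω
      · simp [h]
      · simp [h]
    rw [this]

def GW (p : Fin n → Ω → ℝ) (k : ℕ) (w : (Fin n → Ω) → ℝ) : ℝ :=
  (1 / (n : ℝ) ^ k) * ∑ xs : Fin k → Fin n, ∑ τ : Fin k → Ω,
    |margLaw w xs τ - totW w * ∏ i, p (xs i) (τ i)|

lemma margLaw_cons (w : (Fin n → Ω) → ℝ) {k : ℕ} (x : Fin n) (ω : Ω) (xs : Fin k → Fin n)
    (τ : Fin k → Ω) :
    margLaw w (Fin.cons x xs : Fin (k+1) → Fin n) (Fin.cons ω τ : Fin (k+1) → Ω)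
      = margLaw (pinW w x ω) xs τ := by
  unfold margLaw pinW
  rw [Finset.sum_filter, Finset.sum_filter]
  refine Finset.sum_congr rfl fun σ _ => ?_
  simp only [Fin.forall_fin_succ, Fin.cons_zero, Fin.cons_succ]
  by_cases h : σ x = ω <;> simp [h]

lemma sum_prod_p {p : Fin n → Ω → ℝ} (hp1 : ∀ x, ∑ ω, p x ω = 1) {k : ℕ}
    (xs : Fin k → Fin n) : ∑ τ : Fin k → Ω, ∏ i, p (xs i) (τ i) = 1 := by
  have := Finset.prod_univ_sum (fun _ : Fin k => (Finset.univ : Finset Ω))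
    (fun i ω => p (xs i) ω)
  rw [Fintype.piFinset_univ] at this
  rw [← this]
  simp [hp1]

lemma GW_succ (hn : 0 < n) {p : Fin n → Ω → ℝ} (hp0 : ∀ x ω, 0 ≤ p x ω)
    (hp1 : ∀ x, ∑ ω, p x ω = 1) (k : ℕ) (w : (Fin n → Ω) → ℝ) :
    GW p (k+1) w ≤ (1 / (n : ℝ)) * ∑ x, ∑ ω, GW p k (pinW w x ω)
      + (1 / (n : ℝ)) * ∑ x, ∑ ω, |totW (pinW w x ω) - totW w * p x ω| := by
  have hn' : (n : ℝ) ≠ 0 := by positivity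
  have key : ∀ x : Fin n, ∀ ω : Ω, ∀ xs : Fin k → Fin n,
      ∑ τ : Fin k → Ω, |margLaw (pinW w x ω) xs τ - totW w * (p x ω * ∏ i, p (xs i) (τ i))|
      ≤ ∑ τ : Fin k → Ω, |margLaw (pinW w x ω) xs τ - totW (pinW w x ω) * ∏ i, p (xs i) (τ i)|
        + |totW (pinW w x ω) - totW w * p x ω| := by
    intro x ω xs
    have e : |totW (pinW w x ω) - totW w * p x ω|
        = ∑ τ : Fin k → Ω, |totW (pinW w x ω) - totW w * p x ω| * ∏ i, p (xs i) (τ i) := by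
      rw [← Finset.mul_sum, sum_prod_p hp1, mul_one]
    rw [e, ← Finset.sum_add_distrib]
    refine Finset.sum_le_sum fun τ _ => ?_
    have hP : 0 ≤ ∏ i, p (xs i) (τ i) := Finset.prod_nonneg fun i _ => hp0 _ _
    have e2 : |totW (pinW w x ω) - totW w * p x ω| * ∏ i, p (xs i) (τ i)
        = |(totW (pinW w x ω) - totW w * p x ω) * ∏ i, p (xs i) (τ i)| := by
      rw [abs_mul, abs_of_nonneg hP]
    rw [e2]
    refine le_trans (le_of_eq ?_) (abs_add_le _ _)
    congr 1; ring
  have hL : GW p (k+1) w = (1 / (n : ℝ)) * ∑ x, ∑ ω, (1 / (n : ℝ) ^ k) *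
      ∑ xs : Fin k → Fin n, ∑ τ : Fin k → Ω,
        |margLaw (pinW w x ω) xs τ - totW w * (p x ω * ∏ i, p (xs i) (τ i))| := by
    unfold GW
    rw [sum_consW]
    simp_rw [sum_consW, margLaw_cons, Fin.prod_univ_succ, Fin.cons_zero, Fin.cons_succ,
      ← Finset.mul_sum]
    rw [← mul_assoc, pow_succ]
    congr 1
    · field_simp
    · refine Finset.sum_congr rfl fun x _ => ?_
      rw [Finset.sum_comm]
  rw [hL, ← mul_add, ← Finset.sum_add_distrib]
  refine mul_le_mul_of_nonneg_left ?_ (by positivity)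
  refine Finset.sum_le_sum fun x _ => ?_
  rw [← Finset.sum_add_distrib]
  refine Finset.sum_le_sum fun ω _ => ?_
  have h3 := mul_le_mul_of_nonneg_left (Finset.sum_le_sum fun xs _ => key x ω xs
    : _ ≤ ∑ xs : Fin k → Fin n, _) (show (0 : ℝ) ≤ 1 / (n : ℝ) ^ k by positivity)
  refine h3.trans (le_of_eq ?_)
  rw [Finset.sum_add_distrib, mul_add]
  unfold GW
  congr 1
  simp
  field_simp

lemma BW_le (hn : 0 < n) {lam : ℝ} (hlam : 0 < lam) (p : Fin n → Ω → ℝ)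
    {w : (Fin n → Ω) → ℝ} (hw : ∀ σ, 0 ≤ w σ) :
    (1 / (n : ℝ)) * ∑ x, ∑ ω, |totW (pinW w x ω) - totW w * p x ω|
      ≤ lam * Fintype.card Ω * totW w + (PhiW 0 w - ellW p w) / lam := by
  have h0 : lam * Fintype.card Ω * totW w = (1 / (n : ℝ)) * ∑ _x : Fin n, ∑ _ω : Ω,
      lam * totW w := by
    rw [avg_const hn]; simp; ring
  rw [h0, PhiW, ellW, ← mul_sub, mul_div_assoc, ← mul_add, ← Finset.sum_sub_distrib,
    Finset.sum_div, ← Finset.sum_add_distrib]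
  refine mul_le_mul_of_nonneg_left ?_ (by positivity)
  refine Finset.sum_le_sum fun x _ => ?_
  rw [← Finset.sum_sub_distrib, Finset.sum_div, ← Finset.sum_add_distrib]
  refine Finset.sum_le_sum fun ω _ => ?_
  have h1 := totW_nonneg (pinW_nonneg hw x ω)
  have h2 := totW_pinW_le hw x ω
  rcases (totW_nonneg hw).eq_or_lt with h | h
  · have : totW (pinW w x ω) = 0 := by linarith
    simp [this, ← h]
  · obtain ⟨b, hb⟩ : ∃ b, totW (pinW w x ω) = totW w * b :=
      ⟨totW (pinW w x ω) / totW w, by field_simp⟩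
    rw [hb]
    generalize totW w = m at h
    generalize p x ω = q
    have e : lam * m + ((m * b) ^ 2 / m - (2 * (m * b) * q - m * q ^ 2)) / lam
        = m * (lam + (b - q) ^ 2 / lam) := by
      field_simp; ring
    rw [e, ← mul_sub, abs_mul, abs_of_pos h]
    refine mul_le_mul_of_nonneg_left ?_ h.le
    rw [← sq_abs]
    have h3 : lam + |b - q| ^ 2 / lam = (lam ^ 2 + |b - q| ^ 2) / lam := by field_simp
    rw [h3, le_div_iff₀ hlam]
    nlinarith [sq_nonneg (lam - |b - q|), abs_nonneg (b - q)]

lemma GW_le (hn : 0 < n) {lam : ℝ} (hlam : 0 < lam) {p : Fin n → Ω → ℝ}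
    (hp0 : ∀ x ω, 0 ≤ p x ω) (hp1 : ∀ x, ∑ ω, p x ω = 1) (k : ℕ) :
    ∀ {w : (Fin n → Ω) → ℝ} (_ : ∀ σ, 0 ≤ w σ),
    GW p k w ≤ k * (lam * Fintype.card Ω * totW w + (PhiW k w - ellW p w) / lam) := by
  induction k with
  | zero =>
    intro w hw
    simp [GW, margLaw, totW]
  | succ k ih =>
    intro w hw
    refine (GW_succ hn hp0 hp1 k w).trans ?_
    have h1 := BW_le hn hlam p hw
    have h2 : (1 / (n : ℝ)) * ∑ x, ∑ ω, GW p k (pinW w x ω) ≤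
        k * (lam * Fintype.card Ω * totW w + (PhiW (k+1) w - ellW p w) / lam) := by
      have e : k * (lam * Fintype.card Ω * totW w + (PhiW (k+1) w - ellW p w) / lam)
        = (1 / (n : ℝ)) * ∑ x : Fin n, ∑ ω, k * (lam * Fintype.card Ω * totW (pinW w x ω)
          + (PhiW k (pinW w x ω) - ellW p (pinW w x ω)) / lam) := by
        simp_rw [← Finset.mul_sum, Finset.sum_add_distrib, ← Finset.sum_div,
          Finset.sum_sub_distrib, ← Finset.mul_sum, ellW_pinW, sum_totW_pinW]
        have a1 := avg_const hn (totW w)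
        have a2 := avg_const hn (ellW p w)
        conv_lhs => rw [← a1, ← a2, PhiW]
        ring
      rw [e]
      refine mul_le_mul_of_nonneg_left ?_ (by positivity)
      exact Finset.sum_le_sum fun x _ => Finset.sum_le_sum fun ω _ => ih (pinW_nonneg hw x ω)
    have h3 : (PhiW 0 w - ellW p w) / lam ≤ (PhiW (k+1) w - ellW p w) / lam := by
      have := PhiW_mono hn hw (Nat.zero_le (k+1))
      gcongr
    push_cast
    linarith

lemma marg1_eq (w : (Fin n → Ω) → ℝ) (x : Fin n) (ω : Ω) : marg1 w x ω = totW (pinW w x ω) := by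
  unfold marg1 totW pinW
  rw [Finset.sum_filter]

lemma stateSum_le (hn : 0 < n) {lam : ℝ} (hlam : 0 < lam) (k : ℕ)
    {w : (Fin n → Ω) → ℝ} (hw : ∀ σ, 0 ≤ w σ) (h1 : totW w = 1) :
    stateSum k w ≤ k * (lam * Fintype.card Ω + (PhiW k w - PhiW 0 w) / lam) / 2 := by
  have h := GW_le hn hlam (p := fun x ω => totW (pinW w x ω) / totW w)
    (fun x ω => by simpa [h1] using totW_nonneg (pinW_nonneg hw x ω))
    (fun x => by simp [h1, sum_totW_pinW]) k hw
  rw [ellW_self hw] at h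
  have e : stateSum k w = GW (fun x ω => totW (pinW w x ω) / totW w) k w / 2 := by
    unfold stateSum GW tv
    simp_rw [marg1_eq, h1, one_mul, div_one, ← Finset.sum_div]
    ring
  rw [e]
  rw [h1, mul_one] at h
  rw [h1]
  linarith

lemma exists_time (hn : 0 < n) (k M : ℕ) (hM : 0 < M) {w : (Fin n → Ω) → ℝ}
    (hw : ∀ σ, 0 ≤ w σ) (h1 : totW w = 1) :
    ∃ t, t ≤ M * k ∧ PhiW (t + k) w - PhiW t w ≤ 1 / M := by
  by_contra! hcon
  have h2 : ∑ s ∈ Finset.range M, (1 / (M : ℝ)) <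
      ∑ s ∈ Finset.range M, (PhiW ((s + 1) * k) w - PhiW (s * k) w) := by
    refine Finset.sum_lt_sum_of_nonempty (by simpa using hM.ne') fun s hs => ?_
    have := hcon (s * k) (Nat.mul_le_mul_right _ (Finset.mem_range.1 hs).le)
    rwa [add_mul, one_mul]
  rw [Finset.sum_range_sub (fun s => PhiW (s * k) w)] at h2
  have h3 := PhiW_le hn (M * k) hw
  have h4 := PhiW_nonneg (0 * k) hw
  have : (M : ℝ) ≠ 0 := by positivity
  simp at h2
  rw [mul_inv_cancel₀ this] at h2
  simp at h4
  linarith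

end aux

/-- Corollary: decomposition into `(ε,k)`-states. -/
theorem stmt1 (ε : ℝ) (hε : 0 < ε) (k : ℕ) (hk : 2 ≤ k)
    (Ω : Type) [Fintype Ω] [DecidableEq Ω] (hΩ : 2 ≤ Fintype.card Ω) :
    ∃ η : ℝ, 0 < η ∧ ∀ n : ℕ, 1 / η < (n : ℝ) →
      ∀ μ : (Fin n → Ω) → ℝ, IsPMF μ →
        ∃ N : ℕ, ∃ S : Fin N → Finset (Fin n → Ω),
          (∀ i j, i ≠ j → Disjoint (S i) (S j)) ∧
          (∀ i, IsState ε k μ (S i)) ∧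
          (∀ i, η ≤ mass μ (S i)) ∧
          1 - ε ≤ ∑ i, mass μ (S i) := by
  set d : ℝ := ((Fintype.card Ω : ℕ) : ℝ) with hd
  have hd2 : (2 : ℝ) ≤ d := by rw [hd]; exact_mod_cast hΩ
  have hkR : (2 : ℝ) ≤ k := by exact_mod_cast hk
  have hk0 : (0 : ℝ) < k := by linarith
  have hd0 : (0 : ℝ) < d := by linarith
  obtain ⟨lam, hlam⟩ : ∃ lam : ℝ, lam = ε / (2 * k * d) := ⟨_, rfl⟩
  have hlam0 : 0 < lam := by rw [hlam]; positivity
  obtain ⟨δ, hδ⟩ : ∃ δ : ℝ, δ = ε * lam / (2 * k) := ⟨_, rfl⟩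
  have hδ0 : 0 < δ := by rw [hδ]; positivity
  have hfin : k * (lam * d + δ / lam) = ε := by
    have h1 : δ / lam = ε / (2 * k) := by rw [hδ]; field_simp
    rw [h1, hlam]
    field_simp; norm_num
  obtain ⟨M, hM0, hM⟩ : ∃ M : ℕ, 0 < M ∧ 1 / (M : ℝ) ≤ δ * (ε / 2) := by
    obtain ⟨m, hm⟩ := exists_nat_one_div_lt (show 0 < δ * (ε / 2) by positivity)
    exact ⟨m + 1, by omega, by push_cast; exact hm.le⟩
  have hη0 : 0 < ε / (2 * d ^ (M * k)) := by positivity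
  refine ⟨ε / (2 * d ^ (M * k)), hη0, ?_⟩
  set η := ε / (2 * d ^ (M * k)) with hη
  intro n hn μ hμ
  have hn0 : 0 < n := by
    have : (0 : ℝ) < n := lt_trans (by positivity) hn
    exact_mod_cast this
  have hμ0 := hμ.1
  have htot : totW μ = 1 := hμ.2
  obtain ⟨t, ht, hgap⟩ := exists_time hn0 k M hM0 hμ0 htot
  obtain ⟨L, hL⟩ := exists_label hn0 k t μ
  let S : (Fin t → Ω) → Finset (Fin n → Ω) := fun c => Finset.univ.filter fun σ => L σ = c
  let r : (Fin t → Ω) → (Fin n → Ω) → ℝ := fun c σ => if L σ = c then μ σ else 0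
  have hr0 : ∀ c σ, 0 ≤ r c σ := by
    intro c σ; simp only [r]; split_ifs
    · exact hμ0 σ
    · exact le_rfl
  let g : (Fin t → Ω) → ℝ := fun c => PhiW k (r c) - PhiW 0 (r c)
  have hg0 : ∀ c, 0 ≤ g c := fun c => sub_nonneg.2 (PhiW_mono hn0 (hr0 c) (Nat.zero_le k))
  have hgs : ∑ c, g c ≤ δ * (ε / 2) := (hL.trans hgap).trans hM
  have hmass : ∀ c, mass μ (S c) = totW (r c) := by
    intro c
    simp only [mass, S, r, totW]
    rw [Finset.sum_filter]
  have hm0 : ∀ c, 0 ≤ mass μ (S c) := fun c => by rw [hmass]; exact totW_nonneg (hr0 c)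
  have hmsum : ∑ c, mass μ (S c) = 1 := by
    rw [← htot]
    simp only [hmass, totW, r]
    rw [Finset.sum_comm]
    simp
  let good : Finset (Fin t → Ω) :=
    Finset.univ.filter fun c => η ≤ mass μ (S c) ∧ g c ≤ δ * mass μ (S c)
  have hbad : ∑ c ∈ goodᶜ, mass μ (S c) ≤ ε := by
    have h1 : ∀ c ∈ goodᶜ, mass μ (S c) ≤ η + g c / δ := by
      intro c hc
      simp only [good, Finset.mem_compl, Finset.mem_filter, Finset.mem_univ, true_and,
        not_and_or, not_le] at hc
      have := div_nonneg (hg0 c) hδ0.le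
      rcases hc with h | h
      · linarith
      · have : mass μ (S c) ≤ g c / δ := by
          rw [le_div_iff₀ hδ0]; linarith
        linarith
    have h2 : ∑ c ∈ goodᶜ, (η + g c / δ) ≤ ∑ c, (η + g c / δ) :=
      Finset.sum_le_sum_of_subset_of_nonneg (Finset.subset_univ _)
        fun c _ _ => add_nonneg hη0.le (div_nonneg (hg0 c) hδ0.le)
    have h3 : ∑ c : Fin t → Ω, (η + g c / δ) ≤ ε := by
      have h7 : ∑ c : Fin t → Ω, (η + g c / δ) = ∑ _c : Fin t → Ω, η + (∑ c, g c) / δ := by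
        rw [Finset.sum_add_distrib, Finset.sum_div]
      rw [h7]
      have h4 : (∑ c, g c) / δ ≤ ε / 2 := by
        rw [div_le_iff₀ hδ0]; linarith
      have h5 : ∑ _c : Fin t → Ω, η ≤ ε / 2 := by
        simp only [Finset.sum_const, Finset.card_univ, Fintype.card_pi, Finset.prod_const,
          Fintype.card_fin, nsmul_eq_mul]
        push_cast
        rw [← hd]
        have h6 : d ^ t ≤ d ^ (M * k) := pow_le_pow_right₀ (by linarith) ht
        calc d ^ t * η ≤ d ^ (M * k) * η := by gcongr
          _ = ε / 2 := by rw [hη]; field_simp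
      linarith
    exact (Finset.sum_le_sum h1).trans (h2.trans h3)
  have hgood : 1 - ε ≤ ∑ c ∈ good, mass μ (S c) := by
    have := Finset.sum_add_sum_compl good (fun c => mass μ (S c))
    rw [hmsum] at this
    linarith
  let e := good.equivFin
  refine ⟨good.card, fun i => S (e.symm i).1, ?_, ?_, ?_, ?_⟩
  · intro i j hij
    have hne : (e.symm i).1 ≠ (e.symm j).1 := fun h => hij (e.symm.injective (Subtype.ext h))
    rw [Finset.disjoint_left]
    intro σ h1 h2
    simp only [S, Finset.mem_filter, Finset.mem_univ, true_and] at h1 h2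
    exact hne (h1.symm.trans h2)
  · suffices hS : ∀ c ∈ good, IsState ε k μ (S c) from fun i => hS _ (e.symm i).2
    intro c hc
    obtain ⟨hc1, hc2⟩ := (Finset.mem_filter.1 hc).2
    have hmpos : 0 < mass μ (S c) := lt_of_lt_of_le hη0 hc1
    refine ⟨hmpos, ?_⟩
    have hcond : condPMF μ (S c) = fun σ => (mass μ (S c))⁻¹ * r c σ := by
      funext σ
      simp only [condPMF, r]
      by_cases h : L σ = c
      · rw [if_pos (by simp [S, h]), if_pos h]; ring
      · rw [if_neg (by simp [S, h]), if_neg h]; ring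
    have hinv : 0 < (mass μ (S c))⁻¹ := inv_pos.2 hmpos
    have hb := stateSum_le hn0 hlam0 k (w := condPMF μ (S c))
      (fun σ => by rw [hcond]; exact mul_nonneg hinv.le (hr0 c σ))
      (by rw [hcond, totW_smul, ← hmass, inv_mul_cancel₀ hmpos.ne'])
    have hG : PhiW k (condPMF μ (S c)) - PhiW 0 (condPMF μ (S c)) ≤ δ := by
      rw [hcond, PhiW_smul hinv, PhiW_smul hinv, ← mul_sub, inv_mul_le_iff₀ hmpos]
      linarith
    have hG2 : (PhiW k (condPMF μ (S c)) - PhiW 0 (condPMF μ (S c))) / lam ≤ δ / lam := by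
      gcongr
    rw [← hd] at hb
    generalize (PhiW k (condPMF μ (S c)) - PhiW 0 (condPMF μ (S c))) / lam = z at hb hG2
    have h8 : (k : ℝ) * (lam * d + z) ≤ k * (lam * d + δ / lam) :=
      mul_le_mul_of_nonneg_left (by linarith) hk0.le
    rw [hfin] at h8
    linarith
  · intro i
    exact ((Finset.mem_filter.1 (e.symm i).2).2).1
  · rw [e.symm.sum_comp (fun c : good => mass μ (S c.1)),
      Finset.sum_coe_sort good (fun c => mass μ (S c))]
    exact hgood

end
end

section
/- For every ε > 0, every integer k ≥ 2 and every finite set Ω there exist δ > 0 and η > 0 such that for all n > 1/η and all probability measures μ on Ω^n the following holds: if any two (δ,k)-states S₁, S₂ of μ with μ(S₁), μ(S₂) ≥ η satisfy (1/n) Σ_{x∈[n]} ‖μ_↓x[·|S₁] − μ_↓x[·|S₂]‖_TV < δ, then μ is (ε,k)-symmetric. -/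
open Finset

noncomputable section

def lawOf {X A : Type*} [Fintype X] [DecidableEq A] (μ : X → ℝ) (f : X → A) (a : A) : ℝ :=
  ∑ σ, if f σ = a then μ σ else 0

section Aux
variable {X A B C : Type*} [Fintype X] [DecidableEq A] [DecidableEq B] [DecidableEq C]

theorem lawOf_nonneg (μ : X → ℝ) (hμ : ∀ x, 0 ≤ μ x) (f : X → A) (a : A) : 0 ≤ lawOf μ f a :=
  Finset.sum_nonneg fun σ _ => by split_ifs <;> simp [hμ]

theorem lawOf_sum [Fintype A] (μ : X → ℝ) (f : X → A) : ∑ a, lawOf μ f a = ∑ σ, μ σ := by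
  unfold lawOf
  rw [Finset.sum_comm]
  simp

theorem lawOf_congr {μ : X → ℝ} {f : X → A} {a : A} {g : X → B} {b : B}
    (h : ∀ σ, f σ = a ↔ g σ = b) : lawOf μ f a = lawOf μ g b := by
  unfold lawOf
  exact Finset.sum_congr rfl fun σ _ => by simp [h]

theorem lawOf_marg [Fintype B] (μ : X → ℝ) (f : X → A) (g : X → B) (a : A) :
    ∑ b, lawOf μ (fun σ => (f σ, g σ)) (a, b) = lawOf μ f a := by
  unfold lawOf
  rw [Finset.sum_comm]
  refine Finset.sum_congr rfl fun σ _ => ?_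
  by_cases h : f σ = a <;> simp [h]

theorem lawOf_marg' [Fintype A] (μ : X → ℝ) (f : X → A) (g : X → B) (b : B) :
    ∑ a, lawOf μ (fun σ => (f σ, g σ)) (a, b) = lawOf μ g b := by
  rw [← lawOf_marg μ g f b]
  refine Finset.sum_congr rfl fun a _ => lawOf_congr fun σ => by simp [and_comm]

theorem mass_fiber (μ : X → ℝ) (f : X → A) (a : A) :
    mass μ (univ.filter fun σ => f σ = a) = lawOf μ f a := by
  unfold mass lawOf
  rw [Finset.sum_filter]

theorem lawOf_cond [DecidableEq X] (μ : X → ℝ) (f : X → A) (a : A) (g : X → B) (b : B) :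
    lawOf (condPMF μ (univ.filter fun σ => f σ = a)) g b
      = lawOf μ (fun σ => (f σ, g σ)) (a, b) / lawOf μ f a := by
  conv_lhs => unfold lawOf
  conv_rhs => enter [1]; unfold lawOf
  rw [Finset.sum_div]
  refine Finset.sum_congr rfl fun σ _ => ?_
  unfold condPMF
  rw [mass_fiber]
  by_cases h : f σ = a <;> by_cases h' : g σ = b <;> simp [h, h']

theorem lawOf_cond_mul [DecidableEq X] (μ : X → ℝ) (hμ : ∀ x, 0 ≤ μ x)
    (f : X → A) (a : A) (g : X → B) (b : B) :
    lawOf μ f a * lawOf (condPMF μ (univ.filter fun σ => f σ = a)) g b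
      = lawOf μ (fun σ => (f σ, g σ)) (a, b) := by
  rw [lawOf_cond]
  by_cases h : lawOf μ f a = 0
  · rw [h]
    have h1 : ∀ σ ∈ (univ : Finset X), (if f σ = a then μ σ else 0) = 0 :=
      (Finset.sum_eq_zero_iff_of_nonneg
        (fun σ _ => by split_ifs <;> simp [hμ])).1 h
    symm
    simp only [zero_mul]
    unfold lawOf
    refine Finset.sum_eq_zero fun σ hσ => ?_
    have := h1 σ hσ
    by_cases h2 : f σ = a <;> simp_all
  · field_simp

theorem lawOf_pair_le (μ : X → ℝ) (hμ : ∀ x, 0 ≤ μ x) (f : X → A) (g : X → B) (a : A) (b : B) :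
    lawOf μ (fun σ => (f σ, g σ)) (a, b) ≤ lawOf μ f a := by
  unfold lawOf
  refine Finset.sum_le_sum fun σ _ => ?_
  by_cases h : f σ = a <;> by_cases h' : g σ = b <;> simp [h, h', hμ]

theorem cond_nonneg [DecidableEq X] (μ : X → ℝ) (hμ : ∀ x, 0 ≤ μ x) (S : Finset X) (x : X) :
    0 ≤ condPMF μ S x := by
  unfold condPMF
  split_ifs
  · exact div_nonneg (hμ x) (Finset.sum_nonneg fun i _ => hμ i)
  · exact le_rfl

theorem cond_sum [DecidableEq X] (μ : X → ℝ) (S : Finset X) (h : mass μ S ≠ 0) :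
    ∑ x, condPMF μ S x = 1 := by
  unfold condPMF
  rw [Finset.sum_ite_mem, Finset.univ_inter, ← Finset.sum_div]
  exact div_self h

theorem cond_sum_le [DecidableEq X] (μ : X → ℝ) (S : Finset X) :
    ∑ x, condPMF μ S x ≤ 1 := by
  unfold condPMF
  rw [Finset.sum_ite_mem, Finset.univ_inter, ← Finset.sum_div]
  exact div_self_le_one _

theorem incr_ineq {ι : Type*} [Fintype ι] (p q : ι → ℝ) (hq : ∀ i, 0 ≤ q i)
    (hqp : ∀ i, q i ≤ p i) (t : ℝ) (ht : 0 < t) :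
    ∑ i, |q i - p i * ((∑ j, q j) / ∑ j, p j)| ≤
      (t * (∑ j, p j) + (∑ i, q i ^ 2 / p i - (∑ j, q j) ^ 2 / ∑ j, p j) / t) / 2 := by
  set Q := ∑ j, q j with hQ
  set W := ∑ j, p j with hW
  have hp : ∀ i, 0 ≤ p i := fun i => (hq i).trans (hqp i)
  have key : ∀ i, |q i - p i * (Q / W)| ≤
      (t * p i + (q i ^ 2 / p i - 2 * q i * (Q / W) + p i * (Q / W) ^ 2) / t) / 2 := by
    intro i
    rcases (hp i).eq_or_lt with h | h
    · have : q i = 0 := le_antisymm (h ▸ hqp i) (hq i)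
      simp [← h, this]
    · have e : q i ^ 2 / p i - 2 * q i * (Q / W) + p i * (Q / W) ^ 2
          = (q i - p i * (Q / W)) ^ 2 / p i := by
        field_simp
        generalize Q / W = r
        ring
      rw [e]
      set u := q i - p i * (Q / W)
      have : (t * p i + u ^ 2 / p i / t) / 2 - |u| = (t * p i - |u|) ^ 2 / (2 * t * p i) := by
        field_simp
        rw [← sq_abs u]
        ring
      have h2 : 0 ≤ (t * p i - |u|) ^ 2 / (2 * t * p i) := by positivity
      linarith
  refine (Finset.sum_le_sum fun i _ => key i).trans (le_of_eq ?_)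
  rw [← Finset.sum_div, Finset.sum_add_distrib, ← Finset.mul_sum, ← Finset.sum_div,
    Finset.sum_add_distrib, Finset.sum_sub_distrib, ← Finset.sum_mul, ← Finset.sum_mul,
    ← Finset.mul_sum, ← hQ, ← hW]
  congr 3
  by_cases hW0 : W = 0
  · simp [hW0]
  · field_simp
    ring

theorem sum_fcons {α : Type*} [Fintype α] {k : ℕ} (g : (Fin (k+1) → α) → ℝ) :
    ∑ z, g z = ∑ a, ∑ z', g (Fin.cons a z') := by
  rw [← (Fin.consEquiv fun _ => α).sum_comp, Fintype.sum_prod_type]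
  rfl

end Aux

section Main
variable {Ω : Type} [Fintype Ω] [DecidableEq Ω] {n : ℕ}

def tup {k : ℕ} (z : Fin k → Fin n) (σ : Fin n → Ω) : Fin k → Ω := fun i => σ (z i)

theorem marg1_eq_s2 (μ : (Fin n → Ω) → ℝ) (x : Fin n) (ω : Ω) :
    marg1 μ x ω = lawOf μ (fun σ => σ x) ω := by
  unfold marg1 lawOf
  rw [Finset.sum_filter]

theorem margLaw_eq {k : ℕ} (μ : (Fin n → Ω) → ℝ) (z : Fin k → Fin n) (τ : Fin k → Ω) :
    margLaw μ z τ = lawOf μ (tup z) τ := by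
  unfold margLaw lawOf
  rw [Finset.sum_filter]
  refine Finset.sum_congr rfl fun σ _ => by simp [tup, funext_iff]

def sSum (k : ℕ) (μ : (Fin n → Ω) → ℝ) : ℝ :=
  ∑ z : Fin k → Fin n, ∑ τ : Fin k → Ω,
    |lawOf μ (tup z) τ - ∏ i, lawOf μ (fun σ => σ (z i)) (τ i)|

def dSum (k : ℕ) (μ : (Fin n → Ω) → ℝ) : ℝ :=
  ∑ x : Fin n, ∑ z : Fin k → Fin n, ∑ ω : Ω, ∑ τ : Fin k → Ω,
    |lawOf μ (fun σ => (tup z σ, σ x)) (τ, ω) - lawOf μ (tup z) τ * lawOf μ (fun σ => σ x) ω|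

theorem stateSum_eq (k : ℕ) (μ : (Fin n → Ω) → ℝ) :
    stateSum k μ = sSum k μ / (n : ℝ) ^ k / 2 := by
  unfold stateSum sSum tv
  simp only [marg1_eq_s2, margLaw_eq]
  rw [← Finset.sum_div]
  ring

theorem lawOf_cons {k : ℕ} (μ : (Fin n → Ω) → ℝ) (y : Fin n) (z : Fin k → Fin n)
    (ω : Ω) (τ : Fin k → Ω) :
    lawOf μ (tup (Fin.cons y z)) (Fin.cons ω τ)
      = lawOf μ (fun σ => (tup z σ, σ y)) (τ, ω) := by
  apply lawOf_congr
  intro σ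
  simp [tup, funext_iff, Fin.forall_fin_succ, and_comm]

theorem lawOf_cons2 {k : ℕ} (μ : (Fin n → Ω) → ℝ) (x y : Fin n) (z : Fin k → Fin n)
    (ω ω' : Ω) (τ : Fin k → Ω) :
    lawOf μ (fun σ => (tup (Fin.cons y z) σ, σ x)) (Fin.cons ω' τ, ω)
      = lawOf μ (fun σ => ((tup z σ, σ x), σ y)) ((τ, ω), ω') := by
  apply lawOf_congr
  intro σ
  simp [tup, funext_iff, Fin.forall_fin_succ]
  tauto

theorem dSum_step (k : ℕ) (μ : (Fin n → Ω) → ℝ) : n * dSum k μ ≤ dSum (k+1) μ := by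
  unfold dSum
  rw [Finset.mul_sum]
  refine Finset.sum_le_sum fun x _ => ?_
  rw [sum_fcons]
  have : ∀ c : ℝ, (n : ℝ) * c = ∑ y : Fin n, c := by intro c; simp
  rw [this]
  refine Finset.sum_le_sum fun y _ => Finset.sum_le_sum fun z _ => Finset.sum_le_sum fun ω _ => ?_
  rw [sum_fcons, Finset.sum_comm]
  refine Finset.sum_le_sum fun τ _ => ?_
  simp only [lawOf_cons2, lawOf_cons]
  rw [← lawOf_marg μ (fun σ => (tup z σ, σ x)) (fun σ => σ y),
    ← lawOf_marg μ (tup z) (fun σ => σ y), Finset.sum_mul, ← Finset.sum_sub_distrib]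
  exact Finset.abs_sum_le_sum_abs _ _

theorem sSum_step (k : ℕ) (μ : (Fin n → Ω) → ℝ) (hμ : ∀ x, 0 ≤ μ x) (h1 : ∑ x, μ x = 1) :
    sSum (k+1) μ ≤ dSum k μ + n * sSum k μ := by
  unfold sSum dSum
  have : ∀ c : ℝ, (n : ℝ) * c = ∑ y : Fin n, c := by intro c; simp
  rw [sum_fcons, this, ← Finset.sum_add_distrib]
  refine Finset.sum_le_sum fun x _ => ?_
  rw [← Finset.sum_add_distrib]
  refine Finset.sum_le_sum fun z _ => ?_
  rw [sum_fcons]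
  have e : ∑ τ : Fin k → Ω, |lawOf μ (tup z) τ - ∏ i, lawOf μ (fun σ => σ (z i)) (τ i)|
      = ∑ ω, ∑ τ : Fin k → Ω, lawOf μ (fun σ => σ x) ω *
        |lawOf μ (tup z) τ - ∏ i, lawOf μ (fun σ => σ (z i)) (τ i)| := by
    simp only [← Finset.mul_sum]
    rw [← Finset.sum_mul, lawOf_sum, h1, one_mul]
  rw [e, ← Finset.sum_add_distrib]
  refine Finset.sum_le_sum fun ω _ => ?_
  rw [← Finset.sum_add_distrib]
  refine Finset.sum_le_sum fun τ _ => ?_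
  rw [lawOf_cons, Fin.prod_univ_succ]
  simp only [Fin.cons_zero, Fin.cons_succ]
  have h0 := lawOf_nonneg μ hμ (fun σ : Fin n → Ω => σ x) ω
  rw [← abs_of_nonneg h0, ← abs_mul, abs_of_nonneg h0]
  refine le_trans (le_of_eq ?_) (abs_add_le _ _)
  congr 1
  ring

theorem sSum_le (k : ℕ) (μ : (Fin n → Ω) → ℝ) (hμ : ∀ x, 0 ≤ μ x) (h1 : ∑ x, μ x = 1) :
    n * sSum k μ ≤ k * dSum k μ := by
  induction k with
  | zero =>
    have : sSum 0 μ = 0 := by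
      unfold sSum
      refine Finset.sum_eq_zero fun z _ => Finset.sum_eq_zero fun τ _ => ?_
      have : lawOf μ (tup z) τ = 1 := by
        rw [← h1]; unfold lawOf
        exact Finset.sum_congr rfl fun σ _ => if_pos (Subsingleton.elim _ _)
      simp [this]
    simp [this]
  | succ k ih =>
    have h2 := sSum_step k μ hμ h1
    have h3 := dSum_step k μ
    have hn : (0:ℝ) ≤ n := Nat.cast_nonneg n
    have h4 := mul_le_mul_of_nonneg_left h2 hn
    have h5 := mul_le_mul_of_nonneg_left ih hn
    have h6 := mul_le_mul_of_nonneg_left h3 (show (0:ℝ) ≤ k + 1 by positivity)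
    push_cast
    nlinarith

/-- energy -/
def energy {A : Type} [Fintype A] [DecidableEq A] (μ : (Fin n → Ω) → ℝ) (f : (Fin n → Ω) → A) : ℝ :=
  ∑ x : Fin n, ∑ ω : Ω, ∑ a : A,
    lawOf μ (fun σ => (f σ, σ x)) (a, ω) ^ 2 / lawOf μ f a

variable {A : Type} [Fintype A] [DecidableEq A]

theorem energy_nonneg (μ : (Fin n → Ω) → ℝ) (hμ : ∀ x, 0 ≤ μ x) (f : (Fin n → Ω) → A) :
    0 ≤ energy μ f :=
  Finset.sum_nonneg fun _ _ => Finset.sum_nonneg fun _ _ => Finset.sum_nonneg fun _ _ =>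
    div_nonneg (sq_nonneg _) (lawOf_nonneg μ hμ _ _)

theorem energy_le (μ : (Fin n → Ω) → ℝ) (hμ : ∀ x, 0 ≤ μ x) (h1 : ∑ x, μ x = 1)
    (f : (Fin n → Ω) → A) : energy μ f ≤ n := by
  have : (n : ℝ) = ∑ x : Fin n, ∑ ω : Ω, ∑ a : A, lawOf μ (fun σ => (f σ, σ x)) (a, ω) := by
    simp only [lawOf_marg', lawOf_sum, h1]
    simp
  rw [this]
  refine Finset.sum_le_sum fun x _ => Finset.sum_le_sum fun ω _ => Finset.sum_le_sum fun a _ => ?_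
  have h0 := lawOf_nonneg μ hμ (fun σ => (f σ, σ x)) (a, ω)
  have h2 := lawOf_pair_le μ hμ f (fun σ => σ x) a ω
  rcases (h0.trans h2).eq_or_lt with h | h
  · rw [← h]; simpa using h0
  · rw [div_le_iff₀ h, sq]
    exact mul_le_mul_of_nonneg_left h2 h0

theorem dSum_bound (k : ℕ) (μ : (Fin n → Ω) → ℝ) (hμ : ∀ x, 0 ≤ μ x) (h1 : ∑ x, μ x = 1)
    (f : (Fin n → Ω) → A) (t : ℝ) (ht : 0 < t) :
    ∑ a, lawOf μ f a * dSum k (condPMF μ (univ.filter fun σ => f σ = a)) ≤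
      (t * (Fintype.card Ω * (n : ℝ) ^ (k + 1)) +
        (∑ z : Fin k → Fin n, (energy μ (fun σ => (f σ, tup z σ)) - energy μ f)) / t) / 2 := by
  have key : ∀ (a : A) (x : Fin n) (z : Fin k → Fin n) (ω : Ω),
      ∑ τ : Fin k → Ω, lawOf μ f a *
        |lawOf (condPMF μ (univ.filter fun σ => f σ = a)) (fun σ => (tup z σ, σ x)) (τ, ω)
          - lawOf (condPMF μ (univ.filter fun σ => f σ = a)) (tup z) τ *
            lawOf (condPMF μ (univ.filter fun σ => f σ = a)) (fun σ => σ x) ω| ≤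
      (t * lawOf μ f a + (∑ τ : Fin k → Ω,
        lawOf μ (fun σ => ((f σ, tup z σ), σ x)) ((a, τ), ω) ^ 2
          / lawOf μ (fun σ => (f σ, tup z σ)) (a, τ)
        - lawOf μ (fun σ => (f σ, σ x)) (a, ω) ^ 2 / lawOf μ f a) / t) / 2 := by
    intro a x z ω
    have hi := incr_ineq (fun τ : Fin k → Ω => lawOf μ (fun σ => (f σ, tup z σ)) (a, τ))
      (fun τ => lawOf μ (fun σ => ((f σ, tup z σ), σ x)) ((a, τ), ω))
      (fun τ => lawOf_nonneg μ hμ _ _)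
      (fun τ => lawOf_pair_le μ hμ (fun σ => (f σ, tup z σ)) (fun σ => σ x) (a, τ) ω) t ht
    have hQ : ∑ τ : Fin k → Ω, lawOf μ (fun σ => ((f σ, tup z σ), σ x)) ((a, τ), ω)
        = lawOf μ (fun σ => (f σ, σ x)) (a, ω) := by
      rw [← lawOf_marg μ (fun σ => (f σ, σ x)) (tup z)]
      refine Finset.sum_congr rfl fun τ _ => lawOf_congr fun σ => ?_
      simp only [Prod.mk.injEq]; tauto
    rw [lawOf_marg, hQ] at hi
    refine le_trans (Finset.sum_le_sum fun τ _ => le_of_eq ?_) hi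
    have h0 := lawOf_nonneg μ hμ f a
    rw [← abs_of_nonneg h0, ← abs_mul, abs_of_nonneg h0, mul_sub, ← mul_assoc,
      lawOf_cond_mul μ hμ, lawOf_cond_mul μ hμ, lawOf_cond]
    congr 2
    apply lawOf_congr
    intro σ
    simp only [Prod.mk.injEq]; tauto
  have e1 : ∑ a, lawOf μ f a * dSum k (condPMF μ (univ.filter fun σ => f σ = a))
      ≤ ∑ a, ∑ x : Fin n, ∑ z : Fin k → Fin n, ∑ ω : Ω,
      (t * lawOf μ f a + (∑ τ : Fin k → Ω,
        lawOf μ (fun σ => ((f σ, tup z σ), σ x)) ((a, τ), ω) ^ 2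
          / lawOf μ (fun σ => (f σ, tup z σ)) (a, τ)
        - lawOf μ (fun σ => (f σ, σ x)) (a, ω) ^ 2 / lawOf μ f a) / t) / 2 := by
    unfold dSum
    simp only [Finset.mul_sum]
    refine Finset.sum_le_sum fun a _ => Finset.sum_le_sum fun x _ => Finset.sum_le_sum fun z _ =>
      Finset.sum_le_sum fun ω _ => key a x z ω
  refine e1.trans (le_of_eq ?_)
  simp only [← Finset.sum_div, Finset.sum_add_distrib]
  congr 2
  · simp only [Finset.sum_const, Finset.card_univ, Fintype.card_fun, Fintype.card_fin, nsmul_eq_mul,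
      ← Finset.mul_sum, lawOf_sum, h1]
    push_cast
    ring
  · congr 1
    unfold energy
    simp only [Finset.sum_sub_distrib]
    congr 1
    · rw [Finset.sum_comm]
      rw [Finset.sum_congr rfl fun x _ => Finset.sum_comm]
      rw [Finset.sum_comm]
      refine Finset.sum_congr rfl fun z _ => Finset.sum_congr rfl fun x _ => ?_
      rw [Finset.sum_comm]
      refine Finset.sum_congr rfl fun ω _ => ?_
      rw [Fintype.sum_prod_type]
    · rw [Finset.sum_comm]
      rw [Finset.sum_congr rfl fun x _ => Finset.sum_comm]
      rw [Finset.sum_comm]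
      refine Finset.sum_congr rfl fun z _ => Finset.sum_congr rfl fun x _ => ?_
      rw [Finset.sum_comm]

theorem greedy (k K : ℕ) (hK : 0 < K) (hn : 0 < n) (hc : 1 ≤ Fintype.card Ω)
    (μ : (Fin n → Ω) → ℝ) (hμ : ∀ x, 0 ≤ μ x)
    (h1 : ∑ x, μ x = 1) : ∃ (A : Type) (_ : Fintype A) (_ : DecidableEq A) (f : (Fin n → Ω) → A),
      Fintype.card A ≤ (Fintype.card Ω ^ k) ^ (K + 1) ∧
      ∑ z : Fin k → Fin n, (energy μ (fun σ => (f σ, tup z σ)) - energy μ f)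
        ≤ (n : ℝ) ^ (k + 1) / K := by
  by_contra hcon
  push Not at hcon
  have hnR : (0:ℝ) < n := by exact_mod_cast hn
  have hKR : (0:ℝ) < K := by exact_mod_cast hK
  have : ∀ j : ℕ, j ≤ K + 1 → ∃ (A : Type) (_ : Fintype A) (_ : DecidableEq A)
      (f : (Fin n → Ω) → A),
      Fintype.card A ≤ (Fintype.card Ω ^ k) ^ j ∧ (j : ℝ) * (n / K) ≤ energy μ f := by
    intro j
    induction j with
    | zero =>
      intro _
      exact ⟨Unit, inferInstance, inferInstance, fun _ => (), by simp,
        by simpa using energy_nonneg μ hμ _⟩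
    | succ j ih =>
      intro hj
      obtain ⟨A, i1, i2, f, hA, hf⟩ := ih (by omega)
      have h2 := hcon A i1 i2 f (hA.trans (Nat.pow_le_pow_right (Nat.pow_pos hc) (by omega)))
      have h3 : ∑ z : Fin k → Fin n, ((n:ℝ) / K) <
          ∑ z : Fin k → Fin n, (energy μ (fun σ => (f σ, tup z σ)) - energy μ f) := by
        refine lt_of_eq_of_lt ?_ h2
        simp
        ring
      obtain ⟨z, _, hz⟩ := Finset.exists_lt_of_sum_lt h3
      refine ⟨A × (Fin k → Ω), inferInstance, inferInstance, fun σ => (f σ, tup z σ), ?_, ?_⟩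
      · rw [Fintype.card_prod, pow_succ]
        simp only [Fintype.card_fun, Fintype.card_fin]
        exact Nat.mul_le_mul_right _ hA
      · push_cast
        linarith
  obtain ⟨A, i1, i2, f, hA, hf⟩ := this (K + 1) le_rfl
  have h2 := energy_le μ hμ h1 f
  push_cast at hf
  have : ((K:ℝ) + 1) * (n / K) = n + n / K := by field_simp
  have h3 : (0:ℝ) < n / K := by positivity
  linarith

theorem decomp (k : ℕ) (δ : ℝ) (hδ : 0 < δ) (Ω : Type) [Fintype Ω] [DecidableEq Ω]
    (hc : 1 ≤ Fintype.card Ω) : ∃ N : ℕ, 0 < N ∧ ∀ n : ℕ, 0 < n → ∀ μ : (Fin n → Ω) → ℝ, IsPMF μ →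
      ∃ (A : Type) (_ : Fintype A) (_ : DecidableEq A) (f : (Fin n → Ω) → A),
        Fintype.card A ≤ N ∧
        ∑ a, lawOf μ f a * stateSum k (condPMF μ (univ.filter fun σ => f σ = a)) ≤ δ := by
  set c : ℝ := (Fintype.card Ω : ℝ) with hcdef
  have hcR : (1:ℝ) ≤ c := by rw [hcdef]; exact_mod_cast hc
  set t : ℝ := δ / ((k + 1) * c) with htdef
  have ht : 0 < t := by positivity
  obtain ⟨K, hK⟩ := exists_nat_gt ((k + 1) / (t * δ))
  have hKR : (0:ℝ) < K := lt_of_le_of_lt (by positivity) hK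
  have hK0 : 0 < K := by exact_mod_cast hKR
  refine ⟨(Fintype.card Ω ^ k) ^ (K + 1), Nat.pow_pos (Nat.pow_pos hc), ?_⟩
  intro n hn μ hμ
  obtain ⟨A, i1, i2, f, hA, hf⟩ := greedy k K hK0 hn hc μ hμ.1 hμ.2
  refine ⟨A, i1, i2, f, hA, ?_⟩
  have hnR : (0:ℝ) < n := by exact_mod_cast hn
  have hb := dSum_bound k μ hμ.1 hμ.2 f t ht
  have h2 : ∑ a, lawOf μ f a * stateSum k (condPMF μ (univ.filter fun σ => f σ = a)) ≤
      ∑ a, (k / (2 * (n:ℝ) ^ (k+1))) *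
        (lawOf μ f a * dSum k (condPMF μ (univ.filter fun σ => f σ = a))) := by
    refine Finset.sum_le_sum fun a _ => ?_
    rcases (lawOf_nonneg μ hμ.1 f a).eq_or_lt with h | h
    · rw [← h]; simp
    · have h3 := sSum_le k (condPMF μ (univ.filter fun σ => f σ = a)) (cond_nonneg μ hμ.1 _)
        (cond_sum μ _ (by rw [mass_fiber]; exact h.ne'))
      rw [stateSum_eq]
      set s := sSum k (condPMF μ (univ.filter fun σ => f σ = a))
      set d := dSum k (condPMF μ (univ.filter fun σ => f σ = a))
      have e1 : s / (n:ℝ)^k / 2 = (n * s) / (2 * (n:ℝ)^(k+1)) := by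
        field_simp
        ring
      have e2 : (k / (2 * (n:ℝ) ^ (k+1))) * (lawOf μ f a * d) =
          lawOf μ f a * ((k * d) / (2 * (n:ℝ)^(k+1))) := by ring
      rw [e1, e2]
      gcongr
  rw [← Finset.mul_sum] at h2
  refine h2.trans ?_
  have h4 : ∑ a, lawOf μ f a * dSum k (condPMF μ (univ.filter fun σ => f σ = a)) ≤
      (t * (c * (n : ℝ) ^ (k + 1)) + ((n : ℝ) ^ (k + 1) / K) / t) / 2 := by
    refine hb.trans ?_
    gcongr
  refine (mul_le_mul_of_nonneg_left h4 (by positivity)).trans ?_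
  have e3 : (k / (2 * (n:ℝ) ^ (k+1))) * ((t * (c * (n : ℝ) ^ (k + 1)) +
      ((n : ℝ) ^ (k + 1) / K) / t) / 2) = (k * (t * c) + k / (K * t)) / 4 := by
    field_simp
    ring
  rw [e3]
  have h5 : k * (t * c) ≤ δ := by
    have : t * c = δ / (k + 1) := by rw [htdef]; field_simp
    rw [this, mul_div_assoc', div_le_iff₀ (by positivity)]
    nlinarith
  have h6 : k / (K * t) ≤ δ := by
    rw [div_lt_iff₀ (by positivity)] at hK
    rw [div_le_iff₀ (by positivity)]
    nlinarith
  linarith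

/-- averaged marginal distance -/
def dist1 (μ ν : (Fin n → Ω) → ℝ) : ℝ := ∑ x : Fin n, tv (marg1 μ x) (marg1 ν x)

theorem dist1_le (μ ν : (Fin n → Ω) → ℝ) (hμ : ∀ x, 0 ≤ μ x) (h1 : ∑ x, μ x ≤ 1)
    (hν : ∀ x, 0 ≤ ν x) (h2 : ∑ x, ν x ≤ 1) : dist1 μ ν ≤ n := by
  unfold dist1
  have : (n : ℝ) = ∑ x : Fin n, (1:ℝ) := by simp
  rw [this]
  refine Finset.sum_le_sum fun x _ => ?_
  unfold tv
  have : ∑ ω, |marg1 μ x ω - marg1 ν x ω| ≤ ∑ ω, (marg1 μ x ω + marg1 ν x ω) := by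
    refine Finset.sum_le_sum fun ω _ => ?_
    rw [marg1_eq_s2, marg1_eq_s2]
    have a1 := lawOf_nonneg μ hμ (fun σ => σ x) ω
    have a2 := lawOf_nonneg ν hν (fun σ => σ x) ω
    rw [abs_le]; constructor <;> linarith
  rw [Finset.sum_add_distrib] at this
  simp only [marg1_eq_s2, lawOf_sum] at this ⊢
  linarith

theorem prod_diff (k : ℕ) (p q : Fin n → Ω → ℝ) (hp : ∀ x ω, 0 ≤ p x ω) (hq : ∀ x ω, 0 ≤ q x ω)
    (hp1 : ∀ x, ∑ ω, p x ω = 1) (hq1 : ∀ x, ∑ ω, q x ω = 1) :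
    n * ∑ z : Fin k → Fin n, ∑ τ : Fin k → Ω, |∏ i, p (z i) (τ i) - ∏ i, q (z i) (τ i)| ≤
      k * ((n:ℝ) ^ k * ∑ x, ∑ ω, |p x ω - q x ω|) := by
  induction k with
  | zero => simp
  | succ k ih =>
    set M := ∑ z : Fin k → Fin n, ∑ τ : Fin k → Ω, |∏ i, p (z i) (τ i) - ∏ i, q (z i) (τ i)|
      with hM
    set d := ∑ x, ∑ ω, |p x ω - q x ω| with hd
    have step : ∑ z : Fin (k+1) → Fin n, ∑ τ : Fin (k+1) → Ω,
        |∏ i, p (z i) (τ i) - ∏ i, q (z i) (τ i)| ≤ (n:ℝ) ^ k * d + n * M := by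
      have e0 : (n:ℝ) ^ k * d + n * M = ∑ x : Fin n, ∑ z : Fin k → Fin n,
          ((∑ ω, |p x ω - q x ω|) +
            ∑ τ : Fin k → Ω, |∏ i, p (z i) (τ i) - ∏ i, q (z i) (τ i)|) := by
        simp only [Finset.sum_add_distrib]
        rw [← hM]
        simp [← Finset.mul_sum, hd]
      rw [e0, sum_fcons]
      refine Finset.sum_le_sum fun x _ => Finset.sum_le_sum fun z _ => ?_
      rw [sum_fcons]
      have hq' : ∑ τ : Fin k → Ω, ∏ i, q (z i) (τ i) = 1 := by
        rw [← Fintype.prod_sum]; simp [hq1]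
      have e1 : ∑ ω, |p x ω - q x ω| =
          ∑ ω, ∑ τ : Fin k → Ω, |p x ω - q x ω| * ∏ i, q (z i) (τ i) := by
        simp only [← Finset.mul_sum, hq', mul_one]
      have e2 : ∑ τ : Fin k → Ω, |∏ i, p (z i) (τ i) - ∏ i, q (z i) (τ i)| =
          ∑ ω, ∑ τ : Fin k → Ω, p x ω * |∏ i, p (z i) (τ i) - ∏ i, q (z i) (τ i)| := by
        simp only [← Finset.mul_sum]
        rw [← Finset.sum_mul, hp1, one_mul]
      rw [e1, e2, ← Finset.sum_add_distrib]
      refine Finset.sum_le_sum fun ω _ => ?_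
      rw [← Finset.sum_add_distrib]
      refine Finset.sum_le_sum fun τ _ => ?_
      rw [Fin.prod_univ_succ, Fin.prod_univ_succ]
      simp only [Fin.cons_zero, Fin.cons_succ]
      have a1 := hp x ω
      have a2 : 0 ≤ ∏ i, q (z i) (τ i) := Finset.prod_nonneg fun i _ => hq _ _
      rw [← abs_of_nonneg a1, ← abs_mul, abs_of_nonneg a1]
      nth_rewrite 2 [← abs_of_nonneg a2]
      rw [← abs_mul]
      refine le_trans (le_of_eq ?_) (abs_add_le _ _)
      congr 1
      ring
    have hn : (0:ℝ) ≤ n := Nat.cast_nonneg n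
    have h4 := mul_le_mul_of_nonneg_left step hn
    have h5 := mul_le_mul_of_nonneg_left ih hn
    push_cast
    rw [pow_succ]
    nlinarith

theorem marg1_cond (μ : (Fin n → Ω) → ℝ) (hμ : ∀ x, 0 ≤ μ x) (f : (Fin n → Ω) → A)
    (x : Fin n) (ω : Ω) : marg1 μ x ω =
      ∑ a, lawOf μ f a * marg1 (condPMF μ (univ.filter fun σ => f σ = a)) x ω := by
  simp only [marg1_eq_s2, lawOf_cond_mul μ hμ, lawOf_marg']

theorem dist1_mix (μ : (Fin n → Ω) → ℝ) (hμ : IsPMF μ) (f : (Fin n → Ω) → A)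
    (ν : (Fin n → Ω) → ℝ) : dist1 ν μ ≤
      ∑ b, lawOf μ f b * dist1 ν (condPMF μ (univ.filter fun σ => f σ = b)) := by
  unfold dist1
  simp only [Finset.mul_sum]
  rw [Finset.sum_comm]
  refine Finset.sum_le_sum fun x _ => ?_
  unfold tv
  have : ∑ ω, |marg1 ν x ω - marg1 μ x ω| ≤ ∑ ω, ∑ b, lawOf μ f b *
      |marg1 ν x ω - marg1 (condPMF μ (univ.filter fun σ => f σ = b)) x ω| := by
    refine Finset.sum_le_sum fun ω _ => ?_
    have e : marg1 ν x ω - marg1 μ x ω = ∑ b, lawOf μ f b *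
      (marg1 ν x ω - marg1 (condPMF μ (univ.filter fun σ => f σ = b)) x ω) := by
      simp only [mul_sub, Finset.sum_sub_distrib, ← marg1_cond μ hμ.1 f, ← Finset.sum_mul,
        lawOf_sum, hμ.2, one_mul]
    rw [e]
    refine le_trans (Finset.abs_sum_le_sum_abs _ _) (le_of_eq ?_)
    refine Finset.sum_congr rfl fun b _ => ?_
    rw [abs_mul, abs_of_nonneg (lawOf_nonneg μ hμ.1 f b)]
  rw [Finset.sum_comm] at this
  simp only [mul_div_assoc', ← Finset.sum_div, Finset.mul_sum]
  linarith

theorem state_mix (k : ℕ) (hn : 0 < n) (μ : (Fin n → Ω) → ℝ) (hμ : IsPMF μ)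
    (f : (Fin n → Ω) → A) : stateSum k μ ≤
      ∑ a, lawOf μ f a * (stateSum k (condPMF μ (univ.filter fun σ => f σ = a)) +
        k * (dist1 (condPMF μ (univ.filter fun σ => f σ = a)) μ / n)) := by
  have hnR : (0:ℝ) < n := by exact_mod_cast hn
  have h1 : sSum k μ ≤ ∑ a, lawOf μ f a * ∑ z : Fin k → Fin n, ∑ τ : Fin k → Ω,
      |lawOf (condPMF μ (univ.filter fun σ => f σ = a)) (tup z) τ
        - ∏ i, marg1 μ (z i) (τ i)| := by
    unfold sSum
    simp only [Finset.mul_sum]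
    conv_rhs => rw [Finset.sum_comm]
    refine Finset.sum_le_sum fun z _ => ?_
    conv_rhs => rw [Finset.sum_comm]
    refine Finset.sum_le_sum fun τ _ => ?_
    simp only [← marg1_eq_s2]
    have e : lawOf μ (tup z) τ - ∏ i, marg1 μ (z i) (τ i) = ∑ a, lawOf μ f a *
        (lawOf (condPMF μ (univ.filter fun σ => f σ = a)) (tup z) τ
        - ∏ i, marg1 μ (z i) (τ i)) := by
      simp only [mul_sub, Finset.sum_sub_distrib, lawOf_cond_mul μ hμ.1, lawOf_marg',
        ← Finset.sum_mul, lawOf_sum, hμ.2, one_mul]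
    rw [e]
    refine le_trans (Finset.abs_sum_le_sum_abs _ _) (le_of_eq ?_)
    refine Finset.sum_congr rfl fun b _ => ?_
    rw [abs_mul, abs_of_nonneg (lawOf_nonneg μ hμ.1 f b)]
  have h2 : stateSum k μ ≤ ∑ a, lawOf μ f a * ((∑ z : Fin k → Fin n, ∑ τ : Fin k → Ω,
      |lawOf (condPMF μ (univ.filter fun σ => f σ = a)) (tup z) τ
        - ∏ i, marg1 μ (z i) (τ i)|) / (n:ℝ)^k / 2) := by
    rw [stateSum_eq]
    simp only [mul_div_assoc', ← Finset.sum_div]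
    gcongr
  refine h2.trans (Finset.sum_le_sum fun a _ => ?_)
  rcases (lawOf_nonneg μ hμ.1 f a).eq_or_lt with h | h
  · rw [← h]; simp
  refine mul_le_mul_of_nonneg_left ?_ h.le
  set ν := condPMF μ (univ.filter fun σ => f σ = a) with hν
  have hν0 : ∀ x, 0 ≤ ν x := cond_nonneg μ hμ.1 _
  have hν1 : ∑ x, ν x = 1 := cond_sum μ _ (by rw [mass_fiber]; exact h.ne')
  have hp := prod_diff k (marg1 ν) (marg1 μ)
    (fun x ω => by rw [marg1_eq_s2]; exact lawOf_nonneg _ hν0 _ _)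
    (fun x ω => by rw [marg1_eq_s2]; exact lawOf_nonneg _ hμ.1 _ _)
    (fun x => by simp only [marg1_eq_s2, lawOf_sum, hν1])
    (fun x => by simp only [marg1_eq_s2, lawOf_sum, hμ.2])
  have hd : ∑ x, ∑ ω, |marg1 ν x ω - marg1 μ x ω| = 2 * dist1 ν μ := by
    unfold dist1 tv
    rw [← Finset.sum_div]; ring
  rw [hd] at hp
  set P := ∑ z : Fin k → Fin n, ∑ τ : Fin k → Ω,
    |∏ i, marg1 ν (z i) (τ i) - ∏ i, marg1 μ (z i) (τ i)| with hP
  have h3 : (∑ z : Fin k → Fin n, ∑ τ : Fin k → Ω,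
      |lawOf ν (tup z) τ - ∏ i, marg1 μ (z i) (τ i)|) ≤ sSum k ν + P := by
    unfold sSum
    rw [hP, ← Finset.sum_add_distrib]
    refine Finset.sum_le_sum fun z _ => ?_
    rw [← Finset.sum_add_distrib]
    refine Finset.sum_le_sum fun τ _ => ?_
    simp only [← marg1_eq_s2]
    exact abs_sub_le (lawOf ν (tup z) τ) (∏ i, marg1 ν (z i) (τ i)) _
  have h4 : P / (n:ℝ)^k / 2 ≤ k * (dist1 ν μ / n) := by
    rw [div_div, div_le_iff₀ (by positivity)]
    have : k * (dist1 ν μ / n) * ((n:ℝ)^k * 2) = (k * ((n:ℝ)^k * (2 * dist1 ν μ))) / n := by ring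
    rw [this, le_div_iff₀ hnR]
    linarith
  rw [stateSum_eq]
  have h5 : (∑ z : Fin k → Fin n, ∑ τ : Fin k → Ω,
      |lawOf ν (tup z) τ - ∏ i, marg1 μ (z i) (τ i)|) / (n:ℝ)^k / 2
      ≤ (sSum k ν + P) / (n:ℝ)^k / 2 := by gcongr
  rw [add_div, add_div] at h5
  linarith

end Main

/-- if all large `(δ,k)`-states have similar marginals, then `μ` is
`(ε,k)`-symmetric (i.e. `Ω^n` itself is an `(ε,k)`-state). -/
theorem stmt2 (ε : ℝ) (hε : 0 < ε) (k : ℕ) (hk : 2 ≤ k)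
    (Ω : Type) [Fintype Ω] [DecidableEq Ω] (hΩ : 2 ≤ Fintype.card Ω) :
    ∃ δ : ℝ, 0 < δ ∧ ∃ η : ℝ, 0 < η ∧ ∀ n : ℕ, 1 / η < (n : ℝ) →
      ∀ μ : (Fin n → Ω) → ℝ, IsPMF μ →
        (∀ S₁ S₂ : Finset (Fin n → Ω), IsState δ k μ S₁ → IsState δ k μ S₂ →
          η ≤ mass μ S₁ → η ≤ mass μ S₂ →
          (1 / (n : ℝ)) * ∑ x : Fin n,
              tv (marg1 (condPMF μ S₁) x) (marg1 (condPMF μ S₂) x) < δ) →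
        IsState ε k μ Finset.univ := by
  have hkR : (0:ℝ) < k := by exact_mod_cast (by omega : 0 < k)
  set δ : ℝ := ε / (4 * k) with hδ
  have hδ0 : 0 < δ := by positivity
  set δ' : ℝ := min (ε / 4) (δ * (ε / (16 * k))) with hδ'
  have hδ'0 : 0 < δ' := lt_min (by positivity) (by positivity)
  obtain ⟨N, hN0, hN⟩ := decomp k δ' hδ'0 Ω (by omega)
  have hNR : (0:ℝ) < N := by exact_mod_cast hN0
  set η : ℝ := ε / (16 * k) / N with hη
  have hη0 : 0 < η := by positivity
  refine ⟨δ, hδ0, η, hη0, ?_⟩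
  intro n hn μ hμ hst
  have hnR : (0:ℝ) < n := lt_trans (by positivity) hn
  have hn0 : 0 < n := by exact_mod_cast hnR
  have hmass : mass μ univ = 1 := hμ.2
  refine ⟨by rw [hmass]; exact one_pos, ?_⟩
  have hcond : condPMF μ univ = μ := by
    funext x
    simp [condPMF, hmass]
  rw [hcond]
  obtain ⟨A, i1, i2, f, hA, hf⟩ := hN n hn0 μ hμ
  classical
  set w : A → ℝ := lawOf μ f with hw
  set ν : A → (Fin n → Ω) → ℝ := fun a => condPMF μ (univ.filter fun σ => f σ = a) with hν
  have hw0 : ∀ a, 0 ≤ w a := lawOf_nonneg μ hμ.1 f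
  have hw1 : ∑ a, w a = 1 := by rw [hw, lawOf_sum, hμ.2]
  have hs0 : ∀ a, 0 ≤ stateSum k (ν a) := fun a => by
    rw [stateSum_eq]
    exact div_nonneg (div_nonneg (Finset.sum_nonneg fun _ _ => Finset.sum_nonneg fun _ _ =>
      abs_nonneg _) (by positivity)) (by norm_num)
  let good : A → Prop := fun a => η ≤ w a ∧ stateSum k (ν a) < δ
  let bad : A → ℝ := fun a => if good a then 0 else 1
  have hbad0 : ∀ a, 0 ≤ bad a := fun a => by simp only [bad]; split_ifs <;> norm_num
  -- bad mass
  have hbad : ∑ a, w a * bad a ≤ ε / (8 * k) := by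
    have h1 : ∀ a, w a * bad a ≤ η + (w a * stateSum k (ν a)) / δ := by
      intro a
      have h2 : 0 ≤ (w a * stateSum k (ν a)) / δ :=
        div_nonneg (mul_nonneg (hw0 a) (hs0 a)) hδ0.le
      simp only [bad]
      split_ifs with hg
      · simp only [mul_zero]; linarith
      · simp only [good, not_and_or, not_le, not_lt] at hg
        rcases hg with hg | hg
        · linarith
        · have : w a ≤ (w a * stateSum k (ν a)) / δ := by
            rw [le_div_iff₀ hδ0]
            exact mul_le_mul_of_nonneg_left hg (hw0 a)
          linarith
    refine (Finset.sum_le_sum fun a _ => h1 a).trans ?_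
    rw [Finset.sum_add_distrib, ← Finset.sum_div univ (fun a => w a * stateSum k (ν a)) δ]
    have h3 : ∑ a : A, η ≤ ε / (16 * k) := by
      simp only [Finset.sum_const, Finset.card_univ, nsmul_eq_mul]
      have : (Fintype.card A : ℝ) ≤ N := by exact_mod_cast hA
      calc (Fintype.card A : ℝ) * η ≤ N * η := by gcongr
        _ = ε / (16 * k) := by rw [hη]; field_simp
    have h4 : (∑ a, w a * stateSum k (ν a)) / δ ≤ ε / (16 * k) := by
      rw [div_le_iff₀ hδ0]
      have := min_le_right (ε / 4) (δ * (ε / (16 * k)))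
      linarith
    have h5 : ε / (8 * k) = ε / (16 * k) + ε / (16 * k) := by field_simp; norm_num
    linarith
  have hdist : ∀ a b, dist1 (ν a) (ν b) / n ≤ δ + bad a + bad b := by
    intro a b
    by_cases hab : good a ∧ good b
    · obtain ⟨ha, hb⟩ := hab
      have h := hst (univ.filter fun σ => f σ = a) (univ.filter fun σ => f σ = b)
        ⟨by rw [mass_fiber]; exact hη0.trans_le ha.1, ha.2⟩
        ⟨by rw [mass_fiber]; exact hη0.trans_le hb.1, hb.2⟩
        (by rw [mass_fiber]; exact ha.1) (by rw [mass_fiber]; exact hb.1)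
      have h' : dist1 (ν a) (ν b) / n < δ := by
        rw [div_eq_inv_mul, ← one_div]; exact h
      have := hbad0 a
      have := hbad0 b
      linarith
    · have h1 : dist1 (ν a) (ν b) / n ≤ 1 := by
        rw [div_le_one hnR]
        exact dist1_le _ _ (cond_nonneg μ hμ.1 _) (cond_sum_le μ _) (cond_nonneg μ hμ.1 _)
          (cond_sum_le μ _)
      have h2 : 1 ≤ bad a + bad b := by
        by_cases ha : good a
        · have hb : ¬ good b := fun hb => hab ⟨ha, hb⟩
          have := hbad0 a
          have : bad b = 1 := if_neg hb
          linarith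
        · have := hbad0 b
          have : bad a = 1 := if_neg ha
          linarith
      linarith
  have hdm : ∀ a, dist1 (ν a) μ / n ≤ δ + bad a + ε / (8 * k) := by
    intro a
    have h1 := dist1_mix μ hμ f (ν a)
    have h2 : dist1 (ν a) μ / n ≤ ∑ b, w b * (dist1 (ν a) (ν b) / n) := by
      simp only [mul_div_assoc', ← Finset.sum_div]
      gcongr
    refine h2.trans ((Finset.sum_le_sum fun b _ =>
      mul_le_mul_of_nonneg_left (hdist a b) (hw0 b)).trans ?_)
    simp only [mul_add, Finset.sum_add_distrib, ← Finset.sum_mul, hw1, one_mul]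
    linarith
  have hmix := state_mix k hn0 μ hμ f
  refine lt_of_le_of_lt hmix ?_
  have h3 : ∑ a, w a * (stateSum k (ν a) + k * (dist1 (ν a) μ / n)) ≤
      ∑ a, w a * (stateSum k (ν a) + k * (δ + bad a + ε / (8 * k))) := by
    refine Finset.sum_le_sum fun a _ => mul_le_mul_of_nonneg_left ?_ (hw0 a)
    have := mul_le_mul_of_nonneg_left (hdm a) hkR.le
    linarith
  refine lt_of_le_of_lt h3 ?_
  have e4 : ∑ a, w a * (stateSum k (ν a) + k * (δ + bad a + ε / (8 * k))) =
      ∑ a, w a * stateSum k (ν a) + k * (δ + ∑ a, w a * bad a + ε / (8 * k)) := by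
    have : ∀ a, w a * (stateSum k (ν a) + k * (δ + bad a + ε / (8 * k))) =
        w a * stateSum k (ν a) + (w a * (k * (δ + ε / (8 * k))) + k * (w a * bad a)) := by
      intro a; ring
    simp only [this, Finset.sum_add_distrib, ← Finset.sum_mul, hw1, ← Finset.mul_sum]
    ring
  rw [e4]
  have h5 : ∑ a, w a * stateSum k (ν a) ≤ ε / 4 := hf.trans (min_le_left _ _)
  have h6 : (k:ℝ) * (δ + ∑ a, w a * bad a + ε / (8 * k)) ≤ k * (δ + ε / (8 * k) + ε / (8 * k)) := by
    gcongr
  have h7 : (k:ℝ) * (δ + ε / (8 * k) + ε / (8 * k)) = ε / 2 := by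
    rw [hδ]; field_simp; norm_num
  linarith

end
end

section
/- For every ε > 0 and every finite set Ω there is γ > 0 such that for every η > 0 there exists δ > 0 such that for all n > 1/δ and all probability measures μ on Ω^n the following holds: if μ is (δ,2)-symmetric, then every (γ,2)-state S of μ with μ(S) ≥ η satisfies (1/n) Σ_{x∈[n]} ‖μ_↓x[·|S] − μ_↓x‖_TV < ε. -/
open Finset

noncomputable section

lemma aux_ind {Ω : Type} [Fintype Ω] [DecidableEq Ω] {n : ℕ} (μ : (Fin n → Ω) → ℝ)
    (x : Fin n) (ω : Ω) :
    marg1 μ x ω = ∑ σ, μ σ * (if σ x = ω then (1:ℝ) else 0) := by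
  simp [marg1, Finset.sum_filter]

lemma aux_var {Ω : Type} [Fintype Ω] [DecidableEq Ω] {n : ℕ} (μ : (Fin n → Ω) → ℝ)
    (hμ : IsPMF μ) (ω : Ω) (s : Fin n → ℝ) (hs : ∀ x, |s x| ≤ 1) :
    ∑ σ, μ σ * (∑ x, s x * ((if σ x = ω then (1:ℝ) else 0) - marg1 μ x ω)) ^ 2
      ≤ ∑ xs : Fin 2 → Fin n,
        2 * tv (margLaw μ xs) (fun τ : Fin 2 → Ω => ∏ i, marg1 μ (xs i) (τ i)) := by
  have h1 : ∑ σ, μ σ * (∑ x, s x * ((if σ x = ω then (1:ℝ) else 0) - marg1 μ x ω)) ^ 2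
      = ∑ x, ∑ y, s x * s y * (margLaw μ ![x, y] (fun _ => ω) - marg1 μ x ω * marg1 μ y ω) := by
    have hc : ∀ x y, margLaw μ ![x, y] (fun _ => ω) - marg1 μ x ω * marg1 μ y ω
        = ∑ σ, μ σ * (((if σ x = ω then (1:ℝ) else 0) - marg1 μ x ω) *
            ((if σ y = ω then (1:ℝ) else 0) - marg1 μ y ω)) := by
      intro x y
      have e : ∀ σ, μ σ * (((if σ x = ω then (1:ℝ) else 0) - marg1 μ x ω) *
            ((if σ y = ω then (1:ℝ) else 0) - marg1 μ y ω))
          = (if σ x = ω ∧ σ y = ω then μ σ else 0)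
            - marg1 μ y ω * (μ σ * (if σ x = ω then (1:ℝ) else 0))
            - marg1 μ x ω * (μ σ * (if σ y = ω then (1:ℝ) else 0))
            + marg1 μ x ω * marg1 μ y ω * μ σ := by
        intro σ
        by_cases h1 : σ x = ω <;> by_cases h2 : σ y = ω <;> simp [h1, h2] <;> ring
      simp_rw [e]
      rw [Finset.sum_add_distrib, Finset.sum_sub_distrib, Finset.sum_sub_distrib,
        ← Finset.mul_sum, ← Finset.mul_sum, ← Finset.mul_sum, ← aux_ind, ← aux_ind, hμ.2]
      have : margLaw μ ![x, y] (fun _ => ω) = ∑ σ, (if σ x = ω ∧ σ y = ω then μ σ else 0) := by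
        simp [margLaw, Finset.sum_filter, Fin.forall_fin_two]
      rw [this]; ring
    simp_rw [hc, pow_two, Finset.sum_mul_sum, Finset.mul_sum]
    rw [Finset.sum_comm]
    refine Finset.sum_congr rfl fun x _ => ?_
    rw [Finset.sum_comm]
    refine Finset.sum_congr rfl fun y _ => Finset.sum_congr rfl fun σ _ => ?_
    ring
  rw [h1, ← Fintype.sum_prod_type', ← (finTwoArrowEquiv (Fin n)).sum_comp]
  refine Finset.sum_le_sum fun xs _ => ?_
  have hx : ![xs 0, xs 1] = xs := by ext i; fin_cases i <;> rfl
  have h2 : |margLaw μ xs (fun _ => ω) - marg1 μ (xs 0) ω * marg1 μ (xs 1) ω|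
      ≤ 2 * tv (margLaw μ xs) (fun τ : Fin 2 → Ω => ∏ i, marg1 μ (xs i) (τ i)) := by
    have := Finset.single_le_sum
      (f := fun τ : Fin 2 → Ω => |margLaw μ xs τ - ∏ i, marg1 μ (xs i) (τ i)|)
      (fun τ _ => abs_nonneg _) (Finset.mem_univ (fun _ => ω))
    simp only [Fin.prod_univ_two] at this
    simp only [tv, Fin.prod_univ_two]
    linarith
  refine le_trans ?_ h2
  change s (xs 0) * s (xs 1) * (margLaw μ ![xs 0, xs 1] (fun _ => ω)
    - marg1 μ (xs 0) ω * marg1 μ (xs 1) ω) ≤ _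
  rw [hx]
  refine (le_abs_self _).trans ?_
  rw [abs_mul, abs_mul]
  have := mul_le_one₀ (hs (xs 0)) (abs_nonneg _) (hs (xs 1))
  exact mul_le_of_le_one_left (abs_nonneg _) this

lemma aux_om {Ω : Type} [Fintype Ω] [DecidableEq Ω] {n : ℕ} (μ : (Fin n → Ω) → ℝ)
    (hμ : IsPMF μ) (ω : Ω) (S : Finset (Fin n → Ω)) (hS : 0 < mass μ S) :
    (mass μ S * ∑ x, |marg1 (condPMF μ S) x ω - marg1 μ x ω|) ^ 2
      ≤ ∑ xs : Fin 2 → Fin n,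
        2 * tv (margLaw μ xs) (fun τ : Fin 2 → Ω => ∏ i, marg1 μ (xs i) (τ i)) := by
  set s : Fin n → ℝ := fun x =>
    if 0 ≤ marg1 (condPMF μ S) x ω - marg1 μ x ω then 1 else -1 with hsdef
  have hs : ∀ x, |s x| ≤ 1 := by intro x; simp only [hsdef]; split_ifs <;> simp
  refine le_trans ?_ (aux_var μ hμ ω s hs)
  have hsa : ∀ x, |marg1 (condPMF μ S) x ω - marg1 μ x ω|
      = s x * (marg1 (condPMF μ S) x ω - marg1 μ x ω) := by
    intro x; simp only [hsdef]; split_ifs with h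
    · rw [abs_of_nonneg h, one_mul]
    · rw [abs_of_neg (not_le.mp h)]; ring
  have hm : ∀ x, mass μ S * (marg1 (condPMF μ S) x ω - marg1 μ x ω)
      = ∑ σ ∈ S, μ σ * ((if σ x = ω then (1:ℝ) else 0) - marg1 μ x ω) := by
    intro x
    rw [mul_sub, aux_ind (condPMF μ S)]
    simp only [mul_sub, Finset.sum_sub_distrib, ← Finset.sum_mul]
    congr 1
    rw [Finset.mul_sum, ← Finset.sum_subset (Finset.subset_univ S)]
    · refine Finset.sum_congr rfl fun σ hσ => ?_
      simp only [condPMF, hσ, if_true]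
      field_simp
    · intro σ _ hσ; simp [condPMF, hσ]
  have h1 : mass μ S * ∑ x, |marg1 (condPMF μ S) x ω - marg1 μ x ω|
      = ∑ σ ∈ S, μ σ * ∑ x, s x * ((if σ x = ω then (1:ℝ) else 0) - marg1 μ x ω) := by
    simp_rw [hsa, Finset.mul_sum]
    rw [Finset.sum_comm]
    refine Finset.sum_congr rfl fun x _ => ?_
    rw [mul_left_comm, hm, Finset.mul_sum]
    refine Finset.sum_congr rfl fun σ _ => ?_
    ring
  rw [h1]
  set Y : (Fin n → Ω) → ℝ := fun σ =>
    ∑ x, s x * ((if σ x = ω then (1:ℝ) else 0) - marg1 μ x ω)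
  change (∑ σ ∈ S, μ σ * Y σ) ^ 2 ≤ ∑ σ, μ σ * Y σ ^ 2
  have h2 : (∑ σ ∈ S, μ σ * Y σ) ^ 2 ≤ (∑ σ ∈ S, μ σ) * ∑ σ ∈ S, μ σ * Y σ ^ 2 := by
    refine Finset.sum_sq_le_sum_mul_sum_of_sq_eq_mul S (fun σ _ => hμ.1 σ)
      (fun σ _ => mul_nonneg (hμ.1 σ) (sq_nonneg _)) (fun σ _ => by ring)
  have h3 : ∑ σ ∈ S, μ σ ≤ 1 := hμ.2 ▸
    Finset.sum_le_sum_of_subset_of_nonneg (Finset.subset_univ S) (fun σ _ _ => hμ.1 σ)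
  have h4 : ∑ σ ∈ S, μ σ * Y σ ^ 2 ≤ ∑ σ, μ σ * Y σ ^ 2 :=
    Finset.sum_le_sum_of_subset_of_nonneg (Finset.subset_univ S)
      (fun σ _ _ => mul_nonneg (hμ.1 σ) (sq_nonneg _))
  have h5 : 0 ≤ ∑ σ ∈ S, μ σ * Y σ ^ 2 :=
    Finset.sum_nonneg (fun σ _ => mul_nonneg (hμ.1 σ) (sq_nonneg _))
  nlinarith

/-- if `μ` is `(δ,2)`-symmetric then large `(γ,2)`-states have
marginals close to those of `μ`. -/
theorem stmt3 (ε : ℝ) (hε : 0 < ε) (Ω : Type) [Fintype Ω] [DecidableEq Ω]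
    (hΩ : 2 ≤ Fintype.card Ω) :
    ∃ γ : ℝ, 0 < γ ∧ ∀ η : ℝ, 0 < η → ∃ δ : ℝ, 0 < δ ∧ ∀ n : ℕ, 1 / δ < (n : ℝ) →
      ∀ μ : (Fin n → Ω) → ℝ, IsPMF μ →
        IsState δ 2 μ Finset.univ →
        ∀ S : Finset (Fin n → Ω), IsState γ 2 μ S → η ≤ mass μ S →
          (1 / (n : ℝ)) * ∑ x : Fin n, tv (marg1 (condPMF μ S) x) (marg1 μ x) < ε := by
  have hK : (0:ℝ) < Fintype.card Ω := by
    have : 0 < Fintype.card Ω := by omega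
    exact_mod_cast this
  refine ⟨1, one_pos, fun η hη => ⟨(η * ε / Fintype.card Ω) ^ 2 / 2, by positivity, ?_⟩⟩
  intro n hn μ hμ hsym S hS hηS
  have hn0 : (0:ℝ) < n := lt_trans (by positivity) hn
  have hc : condPMF μ Finset.univ = μ := by
    funext σ; simp [condPMF, mass, hμ.2]
  have h0 := hsym.2
  rw [hc, stateSum, one_div, inv_mul_lt_iff₀ (by positivity)] at h0
  have hω : ∀ ω, ∑ x, |marg1 (condPMF μ S) x ω - marg1 μ x ω| ≤ n * ε / Fintype.card Ω := by
    intro ω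
    have h1 := aux_om μ hμ ω S hS.1
    rw [← Finset.mul_sum] at h1
    have hA : 0 ≤ ∑ x, |marg1 (condPMF μ S) x ω - marg1 μ x ω| :=
      Finset.sum_nonneg (fun _ _ => abs_nonneg _)
    have h2 : (mass μ S * ∑ x, |marg1 (condPMF μ S) x ω - marg1 μ x ω|) ^ 2
        ≤ (η * (n * ε / Fintype.card Ω)) ^ 2 := by
      have : (η * (n * ε / Fintype.card Ω)) ^ 2
        = 2 * ((n:ℝ) ^ 2 * ((η * ε / Fintype.card Ω) ^ 2 / 2)) := by ring
      rw [this]; linarith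
    have h3 := abs_le_of_sq_le_sq h2 (by positivity)
    have h4 := (abs_le.mp (abs_le_of_sq_le_sq h2 (by positivity))).2
    have h5 := mul_le_mul_of_nonneg_right hηS hA
    exact le_of_mul_le_mul_left (h5.trans h4) hη
  have hsum : ∑ x : Fin n, tv (marg1 (condPMF μ S) x) (marg1 μ x) ≤ n * ε / 2 := by
    simp only [tv]
    rw [← Finset.sum_div, Finset.sum_comm]
    have := Finset.sum_le_sum (fun ω (_ : ω ∈ (Finset.univ : Finset Ω)) => hω ω)
    rw [Finset.sum_const, Finset.card_univ, nsmul_eq_mul, mul_div_cancel₀ _ hK.ne'] at this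
    linarith
  rw [one_div, inv_mul_lt_iff₀ hn0]
  have : 0 < n * ε := by positivity
  linarith

end
end

section
/- For every ε > 0 and every finite set Ω there exists δ > 0 such that for all sufficiently large n the following holds: if a probability measure μ on Ω^n is (δ,2)-symmetric, then the product measure μ ⊗ μ, regarded as a probability measure on (Ω × Ω)^n by pairing the i-th coordinates of the two copies, is (ε,2)-symmetric (as a measure on (Ω×Ω)^n). -/
open Finset

noncomputable section

theorem margLaw_tensor_aux {Ω : Type*} [Fintype Ω] [DecidableEq Ω] {n k : ℕ} (μ : (Fin n → Ω) → ℝ)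
    (xs : Fin k → Fin n) (τ : Fin k → Ω × Ω) :
    margLaw (tensorPMF μ) xs τ =
      margLaw μ xs (fun i => (τ i).1) * margLaw μ xs (fun i => (τ i).2) := by
  unfold margLaw tensorPMF
  simp only [Finset.sum_filter]
  rw [Finset.sum_mul_sum, ← Finset.sum_product', Finset.univ_product_univ,
    ← (Equiv.arrowProdEquivProdArrow (Fin n) (fun _ => Ω) (fun _ => Ω)).sum_comp]
  refine Finset.sum_congr rfl fun σ _ => ?_
  have e1 : (Equiv.arrowProdEquivProdArrow (Fin n) (fun _ => Ω) (fun _ => Ω) σ).1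
      = fun i => (σ i).1 := rfl
  have e2 : (Equiv.arrowProdEquivProdArrow (Fin n) (fun _ => Ω) (fun _ => Ω) σ).2
      = fun i => (σ i).2 := rfl
  rw [e1, e2]
  have e3 : (∀ i, σ (xs i) = τ i) ↔
      (∀ i, (σ (xs i)).1 = (τ i).1) ∧ (∀ i, (σ (xs i)).2 = (τ i).2) := by
    simp only [Prod.ext_iff, forall_and]
  by_cases h1 : ∀ i, (σ (xs i)).1 = (τ i).1
  · by_cases h2 : ∀ i, (σ (xs i)).2 = (τ i).2
    · rw [if_pos (e3.2 ⟨h1, h2⟩), if_pos h1, if_pos h2]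
    · rw [if_neg (fun h => h2 (e3.1 h).2), if_neg h2, mul_zero]
  · rw [if_neg (fun h => h1 (e3.1 h).1), if_neg h1, zero_mul]

theorem marg1_eq_aux {Ω : Type*} [Fintype Ω] [DecidableEq Ω] {n : ℕ} (μ : (Fin n → Ω) → ℝ)
    (x : Fin n) (ω : Ω) :
    marg1 μ x ω = margLaw μ (fun _ : Fin 1 => x) (fun _ => ω) := by
  unfold marg1 margLaw
  simp

theorem marg1_tensor_aux {Ω : Type*} [Fintype Ω] [DecidableEq Ω] {n : ℕ} (μ : (Fin n → Ω) → ℝ)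
    (x : Fin n) (ω : Ω × Ω) :
    marg1 (tensorPMF μ) x ω = marg1 μ x ω.1 * marg1 μ x ω.2 := by
  simp only [marg1_eq_aux, margLaw_tensor_aux]

theorem margLaw_pmf_aux {Ω : Type*} [Fintype Ω] [DecidableEq Ω] {n k : ℕ} (μ : (Fin n → Ω) → ℝ)
    (h : IsPMF μ) (xs : Fin k → Fin n) : IsPMF (margLaw μ xs) := by
  refine ⟨fun τ => Finset.sum_nonneg fun σ _ => h.1 σ, ?_⟩
  unfold margLaw
  simp only [Finset.sum_filter, ← funext_iff]
  rw [Finset.sum_comm, ← h.2]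
  refine Finset.sum_congr rfl fun σ _ => ?_
  exact (Finset.sum_ite_eq Finset.univ (fun i => σ (xs i)) (fun _ => μ σ)).trans (by simp)

theorem marg1_pmf_aux {Ω : Type*} [Fintype Ω] [DecidableEq Ω] {n : ℕ} (μ : (Fin n → Ω) → ℝ)
    (h : IsPMF μ) (x : Fin n) : IsPMF (marg1 μ x) := by
  refine ⟨fun τ => Finset.sum_nonneg fun σ _ => h.1 σ, ?_⟩
  unfold marg1
  simp only [Finset.sum_filter]
  rw [Finset.sum_comm, ← h.2]
  refine Finset.sum_congr rfl fun σ _ => ?_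
  simp

theorem prod_pmf_aux {Ω : Type*} [Fintype Ω] [DecidableEq Ω] {k : ℕ} (p : Fin k → Ω → ℝ)
    (h : ∀ i, IsPMF (p i)) : IsPMF (fun τ : Fin k → Ω => ∏ i, p i (τ i)) := by
  refine ⟨fun τ => Finset.prod_nonneg fun i _ => (h i).1 _, ?_⟩
  rw [← Fintype.prod_sum]
  exact Finset.prod_eq_one fun i _ => (h i).2

theorem tv_prod_aux {X : Type*} [Fintype X] (p q : X → ℝ) (hp : IsPMF p) (hq : IsPMF q) :
    ∑ z : X × X, |p z.1 * p z.2 - q z.1 * q z.2| ≤ 2 * ∑ x, |p x - q x| := by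
  calc _ ≤ ∑ z : X × X, (|p z.1 - q z.1| * p z.2 + q z.1 * |p z.2 - q z.2|) := by
        refine Finset.sum_le_sum fun z _ => ?_
        have e : p z.1 * p z.2 - q z.1 * q z.2
            = (p z.1 - q z.1) * p z.2 + q z.1 * (p z.2 - q z.2) := by ring
        rw [e]
        refine (abs_add_le _ _).trans ?_
        rw [abs_mul, abs_mul, abs_of_nonneg (hp.1 _), abs_of_nonneg (hq.1 _)]
    _ = _ := by
        rw [Finset.sum_add_distrib, ← Finset.univ_product_univ, Finset.sum_product,
          Finset.sum_product]
        simp only [← Finset.mul_sum, ← Finset.sum_mul, hp.2, hq.2]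
        ring

theorem stateSum_tensor_aux {Ω : Type*} [Fintype Ω] [DecidableEq Ω] {n : ℕ} (k : ℕ)
    (μ : (Fin n → Ω) → ℝ) (h : IsPMF μ) :
    stateSum k (tensorPMF μ) ≤ 2 * stateSum k μ := by
  unfold stateSum
  rw [mul_left_comm]
  refine mul_le_mul_of_nonneg_left ?_ (by positivity)
  rw [Finset.mul_sum]
  refine Finset.sum_le_sum fun xs _ => ?_
  have key := tv_prod_aux (margLaw μ xs) (fun τ : Fin k → Ω => ∏ i, marg1 μ (xs i) (τ i))
    (margLaw_pmf_aux μ h xs) (prod_pmf_aux _ fun i => marg1_pmf_aux μ h (xs i))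
  rw [← (Equiv.arrowProdEquivProdArrow (Fin k) (fun _ => Ω) (fun _ => Ω)).sum_comp] at key
  simp only [Equiv.arrowProdEquivProdArrow, Equiv.coe_fn_mk] at key
  unfold tv
  simp only [margLaw_tensor_aux, marg1_tensor_aux, Finset.prod_mul_distrib]
  linarith

/-- Proposition: tensorisation of symmetry. -/
theorem stmt4 (ε : ℝ) (hε : 0 < ε) (Ω : Type) [Fintype Ω] [DecidableEq Ω]
    (hΩ : 2 ≤ Fintype.card Ω) :
    ∃ δ : ℝ, 0 < δ ∧ ∃ n₀ : ℕ, ∀ n : ℕ, n₀ < n →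
      ∀ μ : (Fin n → Ω) → ℝ, IsPMF μ →
        IsSymmetric δ 2 μ → IsSymmetric ε 2 (tensorPMF μ) := by
  refine ⟨ε / 2, by positivity, 0, fun n _ μ hμ hs => ?_⟩
  have := stateSum_tensor_aux 2 μ hμ
  unfold IsSymmetric at *
  linarith

end
end

section
/- For every finite set Ω there exists ξ₀ = ξ₀(|Ω|) > 0 such that for all 0 < ξ < ξ₀, all n ∈ ℕ, every probability measure μ on Ω^n, every nonempty U ⊆ [n] and every μ̄ ∈ P(Ω) the following holds. If for every S ⊆ U with |S| ≥ ξ|U| one has ⟨‖σ[·|S] − μ̄‖_TV⟩_μ ≤ ξ, then for every ω ∈ Ω and every event Σ ⊆ Ω^n with μ(Σ) ≥ ξ^{1/4} we have |{x ∈ U : |⟨σ[ω|x] | σ ∈ Σ⟩_μ − μ̄(ω)| > ξ^{1/4}}| ≤ ξ^{1/4}|U|. -/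
open Finset

noncomputable section

theorem stmt8_key {Ω : Type} [Fintype Ω] [DecidableEq Ω] {n : ℕ} (μ : (Fin n → Ω) → ℝ)
    (hμ : IsPMF μ) (μbar : Ω → ℝ) (ω : Ω) (E : Finset (Fin n → Ω)) (δ ξ s : ℝ)
    (hδ : 0 < δ) (hδ2 : δ < 1 / 2) (hξ : ξ = δ ^ 4) (hs : |s| = 1) (hE : δ ≤ mass μ E)
    (S : Finset (Fin n)) (hS : S.Nonempty)
    (hexp : expec μ (fun σ => tv (empDist σ S) μbar) ≤ ξ)
    (hx : ∀ x ∈ S, δ ≤ s * (condExpect μ E (fun σ => if σ x = ω then (1 : ℝ) else 0) - μbar ω)) :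
    False := by
  have hm : 0 < mass μ E := lt_of_lt_of_le hδ hE
  have hc : (0 : ℝ) < S.card := by exact_mod_cast hS.card_pos
  have h1 : S.card * δ ≤ ∑ x ∈ S,
      s * (condExpect μ E (fun σ => if σ x = ω then (1 : ℝ) else 0) - μbar ω) := by
    have := Finset.sum_le_sum hx
    simpa using this
  have h2 : ∑ x ∈ S, s * (condExpect μ E (fun σ => if σ x = ω then (1 : ℝ) else 0) - μbar ω)
      = S.card * ((∑ σ ∈ E, μ σ * (s * (empDist σ S ω - μbar ω))) / mass μ E) := by
    have h3 : ∀ x, condExpect μ E (fun σ => if σ x = ω then (1 : ℝ) else 0) - μbar ω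
        = (∑ σ ∈ E, μ σ * ((if σ x = ω then (1 : ℝ) else 0) - μbar ω)) / mass μ E := by
      intro x
      simp only [mul_sub, Finset.sum_sub_distrib, ← Finset.sum_mul, sub_div]
      unfold condExpect
      congr 1
      change _ = mass μ E * _ / _
      field_simp
    simp only [h3]
    rw [← Finset.mul_sum, ← Finset.sum_div, Finset.sum_comm]
    rw [← mul_div_assoc, ← mul_div_assoc, Finset.mul_sum, Finset.mul_sum]
    congr 1
    refine Finset.sum_congr rfl fun σ _ => ?_
    rw [← Finset.mul_sum, Finset.sum_sub_distrib, Finset.sum_boole]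
    simp only [empDist, Finset.sum_const, nsmul_eq_mul]
    field_simp
  have h4 : ∑ σ ∈ E, μ σ * (s * (empDist σ S ω - μbar ω)) ≤ 2 * ξ := by
    have h5 : ∀ σ, μ σ * (s * (empDist σ S ω - μbar ω)) ≤ μ σ * (2 * tv (empDist σ S) μbar) := by
      intro σ
      refine mul_le_mul_of_nonneg_left ?_ (hμ.1 σ)
      refine (le_abs_self _).trans ?_
      rw [abs_mul, hs, one_mul, tv, mul_div_cancel₀ _ (two_ne_zero)]
      exact Finset.single_le_sum (f := fun x => |empDist σ S x - μbar x|)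
        (fun _ _ => abs_nonneg _) (Finset.mem_univ ω)
    have h6 : ∑ σ ∈ E, μ σ * (2 * tv (empDist σ S) μbar)
        ≤ ∑ σ, μ σ * (2 * tv (empDist σ S) μbar) := by
      refine Finset.sum_le_univ_sum_of_nonneg fun σ => mul_nonneg (hμ.1 σ) ?_
      unfold tv
      positivity
    have h7 : ∑ σ, μ σ * (2 * tv (empDist σ S) μbar)
        = 2 * expec μ (fun σ => tv (empDist σ S) μbar) := by
      unfold expec
      rw [Finset.mul_sum]
      exact Finset.sum_congr rfl fun σ _ => by ring
    linarith [Finset.sum_le_sum (s := E) fun σ _ => h5 σ]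
  rw [h2] at h1
  have h8 := le_of_mul_le_mul_left h1 hc
  rw [le_div_iff₀ hm] at h8
  have h9 : δ * δ ≤ 2 * δ ^ 4 := by
    have := mul_le_mul_of_nonneg_left hE hδ.le
    rw [← hξ]; linarith
  nlinarith [mul_pos hδ hδ, mul_pos (mul_pos hδ hδ) (sub_pos.2 hδ2),
    mul_pos (mul_pos (mul_pos hδ hδ) hδ) (sub_pos.2 hδ2)]

/-- if the empirical distribution on every large subset of `U` is close to
`μ̄` on average, then for every event of mass at least `ξ^{1/4}`, on all but a `ξ^{1/4}`
fraction of coordinates of `U` the conditional marginal is `ξ^{1/4}`-close to `μ̄`. -/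
theorem stmt8 (Ω : Type) [Fintype Ω] [DecidableEq Ω] (hΩ : 2 ≤ Fintype.card Ω) :
    ∃ ξ₀ : ℝ, 0 < ξ₀ ∧ ∀ ξ : ℝ, 0 < ξ → ξ < ξ₀ → ∀ n : ℕ,
      ∀ μ : (Fin n → Ω) → ℝ, IsPMF μ → ∀ U : Finset (Fin n), U.Nonempty →
        ∀ μbar : Ω → ℝ, IsPMF μbar →
          (∀ S ⊆ U, ξ * (U.card : ℝ) ≤ (S.card : ℝ) →
            expec μ (fun σ => tv (empDist σ S) μbar) ≤ ξ) →
          ∀ ω : Ω, ∀ E : Finset (Fin n → Ω), ξ ^ ((1 : ℝ) / 4) ≤ mass μ E →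
            (Nat.card {x : Fin n // x ∈ U ∧ ξ ^ ((1 : ℝ) / 4) <
                |condExpect μ E (fun σ => if σ x = ω then (1 : ℝ) else 0) - μbar ω|} : ℝ)
              ≤ ξ ^ ((1 : ℝ) / 4) * (U.card : ℝ) := by
  refine ⟨1 / 16, by norm_num, ?_⟩
  intro ξ h0 hlt n μ hμ U hU μbar hbar hreg ω E hE
  set δ : ℝ := ξ ^ ((1 : ℝ) / 4) with hδdef
  have hδ : 0 < δ := Real.rpow_pos_of_pos h0 _
  have hξ : ξ = δ ^ 4 := by
    rw [hδdef, ← Real.rpow_natCast, ← Real.rpow_mul h0.le]; norm_num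
  have hδ2 : δ < 1 / 2 := by
    refine lt_of_pow_lt_pow_left₀ 4 (by norm_num) ?_
    rw [← hξ]; norm_num at hlt ⊢; exact hlt
  have hUc : (0 : ℝ) < U.card := by exact_mod_cast hU.card_pos
  have key : ∀ s : ℝ, |s| = 1 → ∀ S ⊆ U, (∀ x ∈ S, δ ≤ s *
      (condExpect μ E (fun σ => if σ x = ω then (1 : ℝ) else 0) - μbar ω)) →
      (S.card : ℝ) < ξ * U.card := by
    intro s hs S hSU hx
    by_contra hcon
    push Not at hcon
    have hSc : (0 : ℝ) < S.card := lt_of_lt_of_le (mul_pos h0 hUc) hcon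
    exact stmt8_key μ hμ μbar ω E δ ξ s hδ hδ2 hξ hs hE S
      (Finset.card_pos.1 (by exact_mod_cast hSc)) (hreg S hSU hcon) hx
  have k1 := key 1 (by simp) (U.filter fun x => δ ≤ 1 *
      (condExpect μ E (fun σ => if σ x = ω then (1 : ℝ) else 0) - μbar ω))
      (Finset.filter_subset _ _) (fun x hx => (Finset.mem_filter.1 hx).2)
  have k2 := key (-1) (by simp) (U.filter fun x => δ ≤ -1 *
      (condExpect μ E (fun σ => if σ x = ω then (1 : ℝ) else 0) - μbar ω))
      (Finset.filter_subset _ _) (fun x hx => (Finset.mem_filter.1 hx).2)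
  set A := U.filter fun x => δ ≤ 1 *
      (condExpect μ E (fun σ => if σ x = ω then (1 : ℝ) else 0) - μbar ω) with hA
  set B := U.filter fun x => δ ≤ -1 *
      (condExpect μ E (fun σ => if σ x = ω then (1 : ℝ) else 0) - μbar ω) with hB
  have hcard : Nat.card {x : Fin n // x ∈ U ∧ δ <
      |condExpect μ E (fun σ => if σ x = ω then (1 : ℝ) else 0) - μbar ω|} ≤ A.card + B.card := by
    rw [Nat.card_eq_fintype_card, Fintype.card_subtype]
    refine le_trans (Finset.card_le_card ?_) (Finset.card_union_le A B)
    intro x hx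
    obtain ⟨hxU, hx⟩ := (Finset.mem_filter.1 hx).2
    rw [Finset.mem_union, hA, hB, Finset.mem_filter, Finset.mem_filter]
    rcases lt_abs.1 hx with h | h
    · exact Or.inl ⟨hxU, by linarith⟩
    · exact Or.inr ⟨hxU, by linarith⟩
  have hcard' : (Nat.card {x : Fin n // x ∈ U ∧ δ <
      |condExpect μ E (fun σ => if σ x = ω then (1 : ℝ) else 0) - μbar ω|} : ℝ)
      ≤ A.card + B.card := by exact_mod_cast hcard
  have h3 : 2 * ξ ≤ δ := by
    have h4 : δ ^ 3 ≤ (1 / 2) ^ 3 := pow_le_pow_left₀ hδ.le hδ2.le 3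
    rw [hξ]; nlinarith
  nlinarith

end
end

section
/- Let μ be a probability measure on Ω^n that is (δ,2)-symmetric, and let W ⊆ [n] be nonempty. Then for every ω ∈ Ω, ⟨(σ[ω|W] − ⟨τ[ω|W]⟩_μ)²⟩_μ ≤ δ n² / |W|². -/
open Finset

noncomputable section

lemma aux_tv_point {X : Type*} [Fintype X] (p q : X → ℝ)
    (h : ∑ x, p x = ∑ x, q x) (a : X) : p a - q a ≤ tv p q := by
  classical
  have h0 : ∑ x, (p x - q x) = 0 := by rw [Finset.sum_sub_distrib, h, sub_self]
  have h1 := Finset.add_sum_erase Finset.univ (fun x => p x - q x) (Finset.mem_univ a)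
  have h2 := Finset.add_sum_erase Finset.univ (fun x => |p x - q x|) (Finset.mem_univ a)
  have h3 := Finset.abs_sum_le_sum_abs (fun x => p x - q x) (Finset.univ.erase a)
  have h4 := neg_abs_le (∑ x ∈ Finset.univ.erase a, (p x - q x))
  have h5 := le_abs_self (p a - q a)
  unfold tv
  linarith

lemma aux_sum_marg {Ω : Type*} [Fintype Ω] [DecidableEq Ω] {n : ℕ} (μ : (Fin n → Ω) → ℝ)
    (x : Fin n) : ∑ ω, marg1 μ x ω = ∑ σ, μ σ := by
  unfold marg1
  exact Finset.sum_fiberwise _ _ _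

lemma aux_sum_pair {Ω : Type*} [Fintype Ω] [DecidableEq Ω] {n : ℕ} (μ : (Fin n → Ω) → ℝ)
    (x y : Fin n) : ∑ τ, pairLaw μ x y τ = ∑ σ, μ σ := by
  unfold pairLaw
  rw [← Finset.sum_fiberwise Finset.univ (fun σ : Fin n → Ω => (σ x, σ y)) μ]
  simp only [Prod.ext_iff]

lemma aux_tv_nonneg {X : Type*} [Fintype X] (p q : X → ℝ) : 0 ≤ tv p q := by
  unfold tv; positivity

lemma aux_empDist {V Ω : Type*} [DecidableEq Ω] (σ : V → Ω) (S : Finset V) (ω : Ω) :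
    empDist σ S ω = (∑ x ∈ S, if σ x = ω then (1:ℝ) else 0) / S.card := by
  unfold empDist; simp

lemma aux_mean {Ω : Type*} [Fintype Ω] [DecidableEq Ω] {n : ℕ} (μ : (Fin n → Ω) → ℝ)
    (W : Finset (Fin n)) (ω : Ω) :
    expec μ (fun τ => empDist τ W ω) = (∑ x ∈ W, marg1 μ x ω) / W.card := by
  unfold expec marg1
  simp only [aux_empDist, Finset.sum_filter, ← mul_div_assoc, ← Finset.sum_div, Finset.mul_sum]
  rw [Finset.sum_comm]
  simp

lemma aux_sq {Ω : Type*} [Fintype Ω] [DecidableEq Ω] {n : ℕ} (μ : (Fin n → Ω) → ℝ)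
    (W : Finset (Fin n)) (ω : Ω) :
    expec μ (fun τ => empDist τ W ω ^ 2)
      = (∑ x ∈ W, ∑ y ∈ W, pairLaw μ x y (ω, ω)) / (W.card : ℝ) ^ 2 := by
  unfold expec pairLaw
  simp only [aux_empDist, Finset.sum_filter, div_pow, ← mul_div_assoc, ← Finset.sum_div]
  congr 1
  simp only [sq, Finset.sum_mul_sum]
  simp only [Finset.mul_sum]
  rw [Finset.sum_comm]
  refine Finset.sum_congr rfl fun x _ => ?_
  rw [Finset.sum_comm]
  refine Finset.sum_congr rfl fun y _ => Finset.sum_congr rfl fun σ _ => ?_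
  by_cases h1 : σ x = ω <;> by_cases h2 : σ y = ω <;> simp [h1, h2]

lemma aux_var_s9 {X : Type*} [Fintype X] (μ : X → ℝ) (hμ : IsPMF μ) (f : X → ℝ) :
    expec μ (fun σ => (f σ - expec μ f) ^ 2) = expec μ (fun σ => f σ ^ 2) - expec μ f ^ 2 := by
  have h1 := hμ.2
  have h : ∀ m : ℝ, expec μ (fun σ => (f σ - m) ^ 2)
      = expec μ (fun σ => f σ ^ 2) - 2 * m * expec μ f + m ^ 2 := by
    intro m
    have : m ^ 2 = ∑ σ, μ σ * m ^ 2 := by rw [← Finset.sum_mul, h1, one_mul]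
    rw [this]
    unfold expec
    rw [Finset.mul_sum, ← Finset.sum_sub_distrib, ← Finset.sum_add_distrib]
    refine Finset.sum_congr rfl fun σ _ => ?_
    ring
  rw [h]; ring

/-- `(δ,2)`-symmetry bounds the variance of empirical averages. -/
theorem stmt9 (Ω : Type) [Fintype Ω] [DecidableEq Ω] (hΩ : 2 ≤ Fintype.card Ω)
    (n : ℕ) (δ : ℝ) (μ : (Fin n → Ω) → ℝ) (hμ : IsPMF μ)
    (hsym : (1 / (n : ℝ) ^ 2) * ∑ x : Fin n, ∑ y : Fin n,
        tv (pairLaw μ x y) (fun τ : Ω × Ω => marg1 μ x τ.1 * marg1 μ y τ.2) < δ)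
    (W : Finset (Fin n)) (hW : W.Nonempty) (ω : Ω) :
    expec μ (fun σ => (empDist σ W ω - expec μ (fun τ => empDist τ W ω)) ^ 2)
      ≤ δ * (n : ℝ) ^ 2 / (W.card : ℝ) ^ 2 := by
  have hn : 0 < (n : ℝ) ^ 2 := by
    obtain ⟨x, _⟩ := hW
    have : 0 < n := x.pos
    positivity
  have hc : 0 < (W.card : ℝ) ^ 2 := by
    have := hW.card_pos
    positivity
  rw [aux_var_s9 μ hμ (fun σ => empDist σ W ω), aux_mean, aux_sq, div_pow, ← sub_div]
  refine div_le_div_of_nonneg_right ?_ hc.le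
  rw [sq, Finset.sum_mul_sum, ← Finset.sum_sub_distrib]
  simp only [← Finset.sum_sub_distrib]
  rw [one_div, inv_mul_lt_iff₀ hn, mul_comm] at hsym
  refine le_trans ?_ hsym.le
  calc _ ≤ ∑ x ∈ W, ∑ y ∈ W,
        tv (pairLaw μ x y) (fun τ : Ω × Ω => marg1 μ x τ.1 * marg1 μ y τ.2) := by
        refine Finset.sum_le_sum fun x _ => Finset.sum_le_sum fun y _ => ?_
        refine aux_tv_point (pairLaw μ x y)
          (fun τ : Ω × Ω => marg1 μ x τ.1 * marg1 μ y τ.2) ?_ (ω, ω)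
        rw [aux_sum_pair, Fintype.sum_prod_type, ← Finset.sum_mul_sum, aux_sum_marg,
          aux_sum_marg, hμ.2, one_mul]
    _ ≤ ∑ x ∈ W, ∑ y, tv (pairLaw μ x y) (fun τ : Ω × Ω => marg1 μ x τ.1 * marg1 μ y τ.2) :=
        Finset.sum_le_sum fun x _ => Finset.sum_le_sum_of_subset_of_nonneg
          (Finset.subset_univ _) fun _ _ _ => aux_tv_nonneg _ _
    _ ≤ _ := Finset.sum_le_sum_of_subset_of_nonneg
          (Finset.subset_univ _) fun _ _ _ => Finset.sum_nonneg fun _ _ => aux_tv_nonneg _ _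

end
end
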